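/- Assume b is bounded and set M = sup |b|. Then for any p ≥ d+1, μ > 0, and u ∈ Ŵ^{1,2}_{d+1}(Q) ∩ C(Q̄) with u ≤ 0 on ∂'Q and limsup_{t+|x|→∞, (t,x)∈Q} u ≤ 0 if Q is unbounded: μ ‖u₊‖_{L_p(Q)} ≤ N (K+1) ‖(μu − Lu)₊‖_{L_p(Q)} if μ ≥ (K+1)M², and μ² ‖u₊‖_{L_p(Q)} ≤ N (K+1)² M² ‖(μu − Lu)₊‖_{L_p(Q)} if μ ≤ (K+1)M², where N = N(δ,d,K,p). -/

import Mathlib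

open MeasureTheory ENNReal Set

noncomputable section

/-- The Frobenius norm of a matrix, used as `|D²u|`. -/
def frobNorm {d : ℕ} (m : Matrix (Fin d) (Fin d) ℝ) : ℝ :=
  Real.sqrt (∑ i, ∑ j, (m i j) ^ 2)

/-- The parabolic boundary `∂'Q` of a domain `Q ⊆ ℝ^{d+1}`: the set of points
`(t₀,x₀) ∈ ∂Q` for which there exist `κ > 0` and a continuous curve `x(t)` on `[t₀-κ,t₀]`
with `x(t₀) = x₀` and `(t, x(t)) ∈ Q` for `t ∈ [t₀-κ, t₀)`. -/
def parabolicBoundary {d : ℕ} (Q : Set (ℝ × EuclideanSpace ℝ (Fin d))) :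
    Set (ℝ × EuclideanSpace ℝ (Fin d)) :=
  {z ∈ frontier Q | ∃ κ > (0 : ℝ), ∃ x : ℝ → EuclideanSpace ℝ (Fin d),
    ContinuousOn x (Set.Icc (z.1 - κ) z.1) ∧ x z.1 = z.2 ∧
    ∀ t ∈ Set.Ico (z.1 - κ) z.1, (t, x t) ∈ Q}

abbrev EE (d : ℕ) := EuclideanSpace ℝ (Fin d)
abbrev XX (d : ℕ) := ℝ × EuclideanSpace ℝ (Fin d)

lemma psd_det_le {d : ℕ} (B : Matrix (Fin d) (Fin d) ℝ) (hB : B.PosSemidef) :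
    0 ≤ B.det ∧ B.det ≤ B.trace ^ d := by
  have h1 : B.det = ∏ i, hB.1.eigenvalues i := by
    simpa using hB.1.det_eq_prod_eigenvalues
  have h2 : B.trace = ∑ i, hB.1.eigenvalues i := by
    simpa using hB.1.trace_eq_sum_eigenvalues
  have h0 := hB.eigenvalues_nonneg
  refine ⟨hB.det_nonneg, ?_⟩
  rw [h1, h2]
  calc ∏ i, hB.1.eigenvalues i ≤ ∏ _i : Fin d, ∑ j, hB.1.eigenvalues j := by
        refine Finset.prod_le_prod (fun i _ => h0 i) (fun i _ => ?_)
        exact Finset.single_le_sum (f := hB.1.eigenvalues) (fun j _ => h0 j) (Finset.mem_univ i)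
    _ = _ := by simp

open scoped MatrixOrder in
lemma psd_factor {d : ℕ} (B : Matrix (Fin d) (Fin d) ℝ) (hB : B.PosSemidef) :
    ∃ C : Matrix (Fin d) (Fin d) ℝ, B = C.conjTranspose * C := by
  obtain ⟨X, hX, -, h⟩ := CFC.exists_sqrt_of_isSelfAdjoint_of_quasispectrumRestricts hB.isHermitian
          (QuasispectrumRestricts.nnreal_of_nonneg hB.nonneg)
  refine ⟨X, ?_⟩
  have : X.conjTranspose = X := hX.star_eq
  rw [this]; exact h.symm

lemma elliptic_trace_le {d : ℕ} {δ : ℝ} (a B : Matrix (Fin d) (Fin d) ℝ)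
    (ha : ∀ ξ : EE d, δ * ‖ξ‖ ^ 2 ≤ ∑ i, ∑ j, a i j * ξ i * ξ j) (hB : B.PosSemidef) :
    δ * B.trace ≤ ∑ i, ∑ j, a i j * B i j := by
  obtain ⟨C, rfl⟩ := psd_factor B hB
  have h1 : ∀ k, δ * ∑ i, C k i ^ 2 ≤ ∑ i, ∑ j, a i j * C k i * C k j := by
    intro k
    have := ha (WithLp.toLp 2 (C k))
    simpa [EuclideanSpace.norm_sq_eq] using this
  calc δ * (C.conjTranspose * C).trace = ∑ k, δ * ∑ i, C k i ^ 2 := by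
        simp only [Matrix.trace, Matrix.diag, Matrix.mul_apply, Matrix.conjTranspose_apply, star_trivial]
        rw [Finset.sum_comm, Finset.mul_sum]
        simp [pow_two]
    _ ≤ ∑ k, ∑ i, ∑ j, a i j * C k i * C k j := Finset.sum_le_sum fun k _ => h1 k
    _ = _ := by
        rw [Finset.sum_comm]
        refine Finset.sum_congr rfl fun i _ => ?_
        rw [Finset.sum_comm]
        refine Finset.sum_congr rfl fun j _ => ?_
        simp only [Matrix.mul_apply, Matrix.conjTranspose_apply, star_trivial, Finset.mul_sum]
        refine Finset.sum_congr rfl fun k _ => ?_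
        ring

lemma det_bound {d : ℕ} {δ : ℝ} (hδ : 0 < δ) (a H : Matrix (Fin d) (Fin d) ℝ) (τ : ℝ)
    (ha : ∀ ξ : EE d, δ * ‖ξ‖ ^ 2 ≤ ∑ i, ∑ j, a i j * ξ i * ξ j)
    (hB : (-H).PosSemidef) (hτ : τ ≤ 0) :
    0 ≤ -τ - ∑ i, ∑ j, a i j * H i j ∧
    δ ^ d * |τ * H.det| ≤ (-τ - ∑ i, ∑ j, a i j * H i j) ^ (d + 1) := by
  have h1 := psd_det_le _ hB
  have h2 := elliptic_trace_le a (-H) ha hB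
  have h4 : ∑ i, ∑ j, a i j * (-H) i j = - ∑ i, ∑ j, a i j * H i j := by
    simp [Finset.sum_neg_distrib]
  rw [h4] at h2
  have h5 : 0 ≤ (-H).trace := hB.trace_nonneg
  have h6 : 0 ≤ δ * (-H).trace := by positivity
  have h7 : |H.det| = (-H).det := by
    rw [← abs_of_nonneg h1.1, Matrix.det_neg, abs_mul]; simp
  refine ⟨by linarith, ?_⟩
  rw [abs_mul, h7, abs_of_nonpos hτ]
  set s := -τ - ∑ i, ∑ j, a i j * H i j
  have hs : 0 ≤ s := by simp only [s]; linarith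
  calc δ ^ d * (-τ * (-H).det) = -τ * (δ ^ d * (-H).det) := by ring
    _ ≤ -τ * (δ ^ d * (-H).trace ^ d) := by
        have := h1.2
        gcongr
        linarith
    _ = -τ * (δ * (-H).trace) ^ d := by rw [mul_pow]
    _ ≤ s * s ^ d := by
        have e1 : -τ ≤ s := by simp only [s]; linarith
        have e2 : δ * (-H).trace ≤ s := by simp only [s]; linarith
        gcongr
    _ = s ^ (d + 1) := by ring

/-- determinant of the derivative of the Krylov-Tso map -/
lemma det_tso {d : ℕ} (L : XX d →ₗ[ℝ] XX d) (τ : ℝ) (y g : EE d) (H : Matrix (Fin d) (Fin d) ℝ)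
    (hL : ∀ s (ξ : EE d), L (s, ξ) =
      (τ * s - inner ℝ (s • g + WithLp.toLp 2 (H.mulVec ξ)) y, s • g + WithLp.toLp 2 (H.mulVec ξ))) :
    LinearMap.det L = τ * H.det := by
  let S : XX d →ₗ[ℝ] XX d :=
    { toFun := fun z => (z.1 + inner ℝ z.2 y, z.2)
      map_add' := by intro a b; ext <;> simp [inner_add_left]; ring
      map_smul' := by intro a b; ext <;> simp [inner_smul_left]; ring }
  let b := (Module.Basis.singleton Unit ℝ).prod (EuclideanSpace.basisFun (Fin d) ℝ).toBasis
  have hS : LinearMap.det S = 1 := by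
    rw [← LinearMap.det_toMatrix b]
    have : LinearMap.toMatrix b b S = Matrix.fromBlocks 1 (Matrix.of fun _ j => y j) 0 1 := by
      ext i j
      rcases i with i | i <;> rcases j with j | j <;>
        simp [LinearMap.toMatrix_apply, b, S, Matrix.one_apply, EuclideanSpace.inner_single_left]
    rw [this, Matrix.det_fromBlocks_zero₂₁]; simp
  have hT : LinearMap.det (S ∘ₗ L) = τ * H.det := by
    rw [← LinearMap.det_toMatrix b]
    have : LinearMap.toMatrix b b (S ∘ₗ L) = Matrix.fromBlocks (Matrix.of fun _ _ => τ) 0 (Matrix.of fun i _ => g i) H := by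
      ext i j
      rcases i with i | i <;> rcases j with j | j <;>
        simp [LinearMap.toMatrix_apply, b, S, hL]
    rw [this, Matrix.det_fromBlocks_zero₁₂]; simp
  rw [LinearMap.det_comp, hS, one_mul] at hT
  exact hT

/-- unit vector in the time direction -/
def et (d : ℕ) : XX d := (1, 0)
/-- unit vector in a space direction -/
def ex {d : ℕ} (i : Fin d) : XX d := (0, EuclideanSpace.single i 1)
/-- spatial gradient -/
def gradx {d : ℕ} (w : XX d → ℝ) (z : XX d) : EE d :=
  WithLp.toLp 2 (fun i => fderiv ℝ w z (ex i))
/-- spatial Hessian -/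
def hessx {d : ℕ} (w : XX d → ℝ) (z : XX d) : Matrix (Fin d) (Fin d) ℝ :=
  Matrix.of fun i j => fderiv ℝ (fun y => fderiv ℝ w y (ex i)) z (ex j)

lemma vec_decomp {d : ℕ} (s : ℝ) (ξ : EE d) : ((s, ξ) : XX d) = s • et d + ∑ j, ξ j • ex j := by
  ext
  · simp [et, ex, Prod.fst_sum]
  · simp [et, ex, Prod.snd_sum, Pi.single_apply]

lemma contDiff_gradx {d : ℕ} {w : XX d → ℝ} (hw : ContDiff ℝ (⊤ : ℕ∞) w) :
    ContDiff ℝ (⊤ : ℕ∞) (gradx w) := by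
  unfold gradx
  refine contDiff_euclidean.2 fun i => ?_
  exact (hw.fderiv_right (m := (⊤ : ℕ∞)) (by simp)).clm_apply contDiff_const

lemma contDiff_pd {d : ℕ} {w : XX d → ℝ} (hw : ContDiff ℝ (⊤ : ℕ∞) w) (v : XX d) :
    ContDiff ℝ (⊤ : ℕ∞) (fun y => fderiv ℝ w y v) :=
  (hw.fderiv_right (m := (⊤ : ℕ∞)) (by simp)).clm_apply contDiff_const

/-- the Krylov-Tso map -/
def tsoMap {d : ℕ} (w : XX d → ℝ) (x1 : EE d) (z : XX d) : XX d :=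
  (w z - inner ℝ (gradx w z) (z.2 - x1), gradx w z)

lemma tso_fderiv {d : ℕ} {w : XX d → ℝ} (hw : ContDiff ℝ (⊤ : ℕ∞) w) (x1 : EE d) (z : XX d) :
    ∃ L : XX d →L[ℝ] XX d, HasFDerivAt (tsoMap w x1) L z ∧
      L.det = fderiv ℝ w z (et d) * (hessx w z).det := by
  have hG : HasFDerivAt (gradx w) (fderiv ℝ (gradx w) z) z :=
    ((contDiff_gradx hw).differentiable (by simp)).differentiableAt.hasFDerivAt
  have hwz : HasFDerivAt w (fderiv ℝ w z) z := (hw.differentiable (by simp)).differentiableAt.hasFDerivAt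
  have h2 : HasFDerivAt (fun z : XX d => z.2 - x1) (ContinuousLinearMap.snd ℝ ℝ (EE d)) z :=
    hasFDerivAt_snd.sub_const x1
  have h3 := (hwz.sub (hG.inner ℝ h2)).prodMk hG
  refine ⟨_, h3, ?_⟩
  have key : ∀ v i, (fderiv ℝ (gradx w) z v) i = fderiv ℝ (fun y => fderiv ℝ w y (ex i)) z v := by
    intro v i
    have h4 : HasFDerivAt (fun y => fderiv ℝ w y (ex i)) _ z :=
      ((EuclideanSpace.proj i : EE d →L[ℝ] ℝ).hasFDerivAt (x := gradx w z)).comp z hG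
    rw [h4.fderiv]
    rfl
  rw [ContinuousLinearMap.det]
  refine det_tso _ _ (z.2 - x1) (fderiv ℝ (gradx w) z (et d)) _ ?_
  intro s ξ
  have hGs : fderiv ℝ (gradx w) z (s, ξ) = s • fderiv ℝ (gradx w) z (et d) +
      WithLp.toLp 2 ((hessx w z).mulVec ξ) := by
    rw [vec_decomp s ξ, map_add, map_smul, map_sum]
    congr 1
    ext i
    simp [key, Matrix.mulVec, dotProduct, hessx, mul_comm]
  have hws : fderiv ℝ w z (s, ξ) = fderiv ℝ w z (et d) * s + inner ℝ (gradx w z) ξ := by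
    rw [vec_decomp s ξ, map_add, map_smul, map_sum]
    simp [gradx, PiLp.inner_apply, mul_comm]
  rw [← hGs]
  have : fderiv ℝ (gradx w) z (s, ξ) = fderiv ℝ (gradx w) z ((s, ξ) : XX d) := rfl
  simp only [ContinuousLinearMap.coe_coe, ContinuousLinearMap.prod_apply, sub_apply,
    ContinuousLinearMap.comp_apply, fderivInnerCLM_apply, hws, ContinuousLinearMap.coe_snd']
  ext
  · simp
    ring
  · simp

lemma tso_measure {d : ℕ} {δ : ℝ} (hδ : 0 < δ) {w : XX d → ℝ} (hw : ContDiff ℝ (⊤ : ℕ∞) w) (x1 : EE d)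
    (a : XX d → Matrix (Fin d) (Fin d) ℝ)
    (ha : ∀ z (ξ : EE d), δ * ‖ξ‖ ^ 2 ≤ ∑ i, ∑ j, a z i j * ξ i * ξ j)
    {C : Set (XX d)} (hC : MeasurableSet C)
    (hC1 : ∀ z ∈ C, fderiv ℝ w z (et d) ≤ 0) (hC2 : ∀ z ∈ C, (-hessx w z).PosSemidef) :
    ENNReal.ofReal (δ ^ d) * volume (tsoMap w x1 '' C) ≤
      ∫⁻ z in C, ENNReal.ofReal (-fderiv ℝ w z (et d) - ∑ i, ∑ j, a z i j * hessx w z i j) ^ (d + 1) := by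
  choose L hL hdet using tso_fderiv hw x1
  have : (volume : Measure (XX d)).IsAddHaarMeasure := Measure.prod.instIsAddHaarMeasure _ _
  have h1 := addHaar_image_le_lintegral_abs_det_fderiv (volume : Measure (XX d)) hC
    (fun x _ => (hL x).hasFDerivWithinAt)
  calc ENNReal.ofReal (δ ^ d) * volume (tsoMap w x1 '' C)
      ≤ ENNReal.ofReal (δ ^ d) * ∫⁻ z in C, ENNReal.ofReal |(L z).det| := by gcongr
    _ = ∫⁻ z in C, ENNReal.ofReal (δ ^ d) * ENNReal.ofReal |(L z).det| := by
        rw [lintegral_const_mul' _ _ ENNReal.ofReal_ne_top]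
    _ ≤ _ := by
        refine setLIntegral_mono' hC fun z hz => ?_
        obtain ⟨h0, h2⟩ := det_bound hδ (a z) (hessx w z) (fderiv ℝ w z (et d)) (ha z) (hC2 z hz) (hC1 z hz)
        rw [hdet, ← ENNReal.ofReal_mul (by positivity), ← ENNReal.ofReal_pow h0]
        exact ENNReal.ofReal_le_ofReal h2

lemma second_deriv_nonpos {g g' : ℝ → ℝ} {c : ℝ} (hmax : IsLocalMax g 0)
    (hg : ∀ s, HasDerivAt g (g' s) s) (hg' : HasDerivAt g' c 0) : c ≤ 0 := by
  by_contra hc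
  push Not at hc
  have e1 : deriv g = g' := funext fun s => (hg s).deriv
  have hmin : IsLocalMin g 0 := by
    refine isLocalMin_of_deriv_deriv_pos ?_ ?_ (hg 0).continuousAt
    · rw [e1, hg'.deriv]; exact hc
    · exact hmax.deriv_eq_zero
  have hconst : ∀ᶠ s in nhds (0 : ℝ), g s = g 0 := by
    filter_upwards [hmax, hmin] with s h1 h2
    exact le_antisymm h1 h2
  have h0 : ∀ᶠ s in nhds (0 : ℝ), g' s = 0 := by
    filter_upwards [hconst.eventually_nhds] with s hs
    have : HasDerivAt g 0 s := (hasDerivAt_const s (g 0)).congr_of_eventuallyEq hs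
    exact (hg s).unique this
  have : HasDerivAt g' 0 0 := (hasDerivAt_const (0 : ℝ) (0 : ℝ)).congr_of_eventuallyEq h0
  have := hg'.unique this
  linarith

lemma fderiv_pd {d : ℕ} {w : XX d → ℝ} (hw : ContDiff ℝ (⊤ : ℕ∞) w) (z v v' : XX d) :
    fderiv ℝ (fun y => fderiv ℝ w y v) z v' = fderiv ℝ (fderiv ℝ w) z v' v := by
  have h : HasFDerivAt (fderiv ℝ w) (fderiv ℝ (fderiv ℝ w) z) z :=
    (((hw.fderiv_right (m := (⊤ : ℕ∞)) (by simp))).differentiable (by simp)).differentiableAt.hasFDerivAt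
  have h2 := (h.clm_apply (hasFDerivAt_const v z)).fderiv
  rw [h2]; simp

lemma hessx_quad {d : ℕ} {w : XX d → ℝ} (hw : ContDiff ℝ (⊤ : ℕ∞) w) (z : XX d) (ξ : EE d) :
    fderiv ℝ (fun y => fderiv ℝ w y (0, ξ)) z (0, ξ) = ∑ i, ∑ j, hessx w z i j * ξ i * ξ j := by
  rw [fderiv_pd hw]
  have : ((0, ξ) : XX d) = ∑ j, ξ j • ex j := by rw [vec_decomp]; simp
  rw [this]
  simp only [map_sum, map_smul, sum_apply, hessx, Matrix.of_apply, fderiv_pd hw,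
    FunLike.coe_smul, Pi.smul_apply, smul_eq_mul, Finset.mul_sum]
  refine Finset.sum_congr rfl fun i _ => Finset.sum_congr rfl fun j _ => ?_
  ring

lemma hessx_symm {d : ℕ} {w : XX d → ℝ} (hw : ContDiff ℝ (⊤ : ℕ∞) w) (z : XX d) (i j : Fin d) :
    hessx w z i j = hessx w z j i := by
  simp only [hessx, Matrix.of_apply, fderiv_pd hw]
  have := (hw.contDiffAt (x := z)).isSymmSndFDerivAt (by simp; exact WithTop.coe_le_coe.2 (le_top : (2 : ℕ∞) ≤ ⊤))
  exact this.eq _ _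

lemma hessx_psd {d : ℕ} {w : XX d → ℝ} (hw : ContDiff ℝ (⊤ : ℕ∞) w) (z : XX d)
    (h : ∀ ξ : EE d, ∑ i, ∑ j, hessx w z i j * ξ i * ξ j ≤ 0) : (-hessx w z).PosSemidef := by
  refine .of_dotProduct_mulVec_nonneg ?_ ?_
  · ext i j
    simp [hessx_symm hw z i j]
  · intro x
    have := h (WithLp.toLp 2 x)
    simp only [Matrix.neg_mulVec, dotProduct_neg, star_trivial]
    rw [neg_nonneg]
    refine le_trans (le_of_eq ?_) this
    simp only [dotProduct, Matrix.mulVec, Finset.mul_sum]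
    refine Finset.sum_congr rfl fun i _ => Finset.sum_congr rfl fun j _ => ?_
    ring

lemma contact_exists {d : ℕ} {w : XX d → ℝ} (hw : ContDiff ℝ (⊤ : ℕ∞) w) {D : Set (XX d)}
    (hD : IsCompact D) {x1 p : EE d} {r B h : ℝ} (hr : 0 < r)
    (hh : B / 4 < h) (hp : ‖p‖ < B / (8 * r)) {z1 : XX d} (hz1 : z1 ∈ D) (hz1x : z1.2 = x1)
    (hwz1 : h < w z1) (hDr : ∀ z ∈ D, ‖z.2 - x1‖ ≤ r)
    (hfw : ∀ z ∈ D, B / 8 < w z → ∃ η > 0, ∀ z' : XX d, z.1 ≤ z'.1 → z'.1 < z.1 + η →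
      ‖z'.2 - z.2‖ < η → z' ∈ D) :
    ∃ z ∈ D, tsoMap w x1 z = (h, p) ∧ fderiv ℝ w z (et d) ≤ 0 ∧
      (∀ ξ : EE d, ∑ i, ∑ j, hessx w z i j * ξ i * ξ j ≤ 0) ∧ B / 8 ≤ w z ∧ ‖gradx w z‖ ≤ B / (8 * r) := by
  set q : XX d → ℝ := fun z => w z - h - inner ℝ p (z.2 - x1) with hq
  have hqc : Continuous q := by
    have := hw.continuous
    fun_prop
  have hS : IsCompact (D ∩ {z | 0 ≤ q z}) := hD.inter_right (isClosed_le continuous_const hqc)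
  obtain ⟨z, ⟨hzD, hzq⟩, hmax⟩ := hS.exists_isMaxOn (f := Prod.fst)
    ⟨z1, hz1, by simp [hq, hz1x]; linarith⟩ continuous_fst.continuousOn
  have hzq : 0 ≤ q z := hzq
  have hwz : B / 8 < w z := by
    have h1 : |inner ℝ p (z.2 - x1)| ≤ ‖p‖ * ‖z.2 - x1‖ := abs_real_inner_le_norm _ _
    have h2 : ‖p‖ * ‖z.2 - x1‖ ≤ B / (8 * r) * r :=
      mul_le_mul hp.le (hDr z hzD) (norm_nonneg _) ((norm_nonneg _).trans hp.le)
    have h3 : B / (8 * r) * r = B / 8 := by field_simp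
    have h4 := neg_abs_le (inner ℝ p (z.2 - x1))
    simp only [hq] at hzq
    linarith
  obtain ⟨η, hη, hfwz⟩ := hfw z hzD hwz
  -- strictly later points
  have hlate : ∀ t x, z.1 < t → t < z.1 + η → ‖x - z.2‖ < η → q (t, x) < 0 := by
    intro t x h1 h2 h3
    by_contra hcon
    push Not at hcon
    have : t ≤ z.1 := hmax (show ((t, x) : XX d) ∈ _ from ⟨hfwz (t, x) h1.le h2 h3, hcon⟩)
    linarith
  have hnow : ∀ x, ‖x - z.2‖ < η → q (z.1, x) ≤ 0 := by
    intro x hx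
    have hc : Filter.Tendsto (fun t => q (t, x)) (nhdsWithin z.1 (Ioi z.1)) (nhds (q (z.1, x))) := by
      have : Continuous fun t => q (t, x) := by fun_prop
      exact (this.tendsto z.1).mono_left nhdsWithin_le_nhds
    refine le_of_tendsto hc ?_
    filter_upwards [Ioo_mem_nhdsGT (show z.1 < z.1 + η by linarith)] with t ht
    exact (hlate t x ht.1 ht.2 hx).le
  have hq0 : q z = 0 := le_antisymm (hnow z.2 (by simpa using hη)) hzq
  have hdw : ∀ y, HasFDerivAt w (fderiv ℝ w y) y :=
    fun y => (hw.differentiable (by simp)).differentiableAt.hasFDerivAt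
  -- derivative along lines
  have hline : ∀ (ξ : EE d) (s : ℝ), HasDerivAt (fun s : ℝ => q (z + s • ((0, ξ) : XX d)))
      (fderiv ℝ w (z + s • ((0, ξ) : XX d)) (0, ξ) - inner ℝ p ξ) s := by
    intro ξ s
    have h1 : HasDerivAt (fun s : ℝ => z + s • ((0, ξ) : XX d)) ((0, ξ) : XX d) s := by
      simpa using ((hasDerivAt_id s).smul_const ((0, ξ) : XX d)).const_add z
    have h2 := (hdw (z + s • ((0, ξ) : XX d))).comp_hasDerivAt s h1
    have h3 : HasDerivAt (fun s : ℝ => inner ℝ p ((z + s • ((0, ξ) : XX d)).2 - x1)) (inner ℝ p ξ) s := by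
      have : (fun s : ℝ => inner ℝ p ((z + s • ((0, ξ) : XX d)).2 - x1)) =
          fun s : ℝ => inner ℝ p (z.2 - x1) + s * inner ℝ p ξ := by
        funext s
        simp [inner_add_right, inner_sub_right, inner_smul_right]; ring
      rw [this]
      simpa using ((hasDerivAt_id s).mul_const (inner ℝ p ξ)).const_add (inner ℝ p (z.2 - x1))
    exact (h2.sub_const h).sub h3
  have hlm : ∀ ξ : EE d, IsLocalMax (fun s : ℝ => q (z + s • ((0, ξ) : XX d))) 0 := by
    intro ξ
    have hc : Continuous fun s : ℝ => ‖s • ξ‖ := by fun_prop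
    have : ∀ᶠ s in nhds (0 : ℝ), ‖s • ξ‖ < η :=
      hc.continuousAt.eventually_lt continuousAt_const (by simpa using hη)
    filter_upwards [this] with s hs
    have := hnow (z.2 + s • ξ) (by simpa using hs)
    have e : z + s • ((0, ξ) : XX d) = (z.1, z.2 + s • ξ) := by ext <;> simp
    simp only [e, zero_smul, add_zero, hq0]
    exact this
  have hgrad : ∀ ξ : EE d, fderiv ℝ w z (0, ξ) = inner ℝ p ξ := by
    intro ξ
    have := (hlm ξ).hasDerivAt_eq_zero (hline ξ 0)
    simp only [zero_smul, add_zero] at this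
    linarith
  have hgp : gradx w z = p := by
    ext i
    simp [gradx, ex, hgrad, EuclideanSpace.inner_single_right]
  refine ⟨z, hzD, ?_, ?_, ?_, hwz.le, by rw [hgp]; exact hp.le⟩
  · simp only [tsoMap, hgp]
    ext
    · simp only [hq] at hq0
      simp; linarith
    · simp
  · -- time derivative
    have h1 : HasDerivAt (fun s : ℝ => q (s, z.2)) (fderiv ℝ w z (et d)) z.1 := by
      have h1 : HasDerivAt (fun s : ℝ => ((s, z.2) : XX d)) (et d) z.1 :=
        (hasDerivAt_id z.1).prodMk (hasDerivAt_const z.1 z.2)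
      have h2 := (hdw (z.1, z.2)).comp_hasDerivAt z.1 h1
      exact (h2.sub_const h).sub_const (inner ℝ p (z.2 - x1))
    have h2 := h1.tendsto_slope.mono_left (nhdsWithin_mono z.1 (show Ioi z.1 ⊆ {z.1}ᶜ from fun s hs => ne_of_gt hs))
    refine le_of_tendsto h2 ?_
    filter_upwards [Ioo_mem_nhdsGT (show z.1 < z.1 + η by linarith)] with t ht
    rw [slope_def_field]
    have e : q (z.1, z.2) = 0 := hq0
    have := hlate t z.2 ht.1 ht.2 (by simpa using hη)
    rw [e]
    refine div_nonpos_of_nonpos_of_nonneg (by linarith) (by linarith [ht.1])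
  · intro ξ
    rw [← hessx_quad hw]
    refine second_deriv_nonpos (hlm ξ) (hline ξ) ?_
    have h1 : HasDerivAt (fun s : ℝ => z + s • ((0, ξ) : XX d)) ((0, ξ) : XX d) 0 := by
      simpa using ((hasDerivAt_id (0:ℝ)).smul_const ((0, ξ) : XX d)).const_add z
    have h2 : HasFDerivAt (fun y => fderiv ℝ w y (0, ξ)) (fderiv ℝ (fun y => fderiv ℝ w y (0, ξ)) z)
        (z + (0:ℝ) • ((0, ξ) : XX d)) := by
      simpa using ((contDiff_pd hw (0, ξ)).differentiable (by simp)).differentiableAt.hasFDerivAt (x := z)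
    exact (h2.comp_hasDerivAt (0:ℝ) h1).sub_const _

instance haarXX (d : ℕ) : (volume : Measure (XX d)).IsAddHaarMeasure :=
  Measure.prod.instIsAddHaarMeasure _ _

lemma transl_cont {d : ℕ} {n : ℕ} (hn : 1 ≤ n) {g : XX d → ℝ} (hg : MemLp g n volume) {ε : ℝ≥0∞}
    (hε : ε ≠ 0) :
    ∃ ρ > (0:ℝ), ∀ y : XX d, ‖y‖ < ρ → eLpNorm (fun z => g (z - y) - g z) n volume ≤ ε := by
  have : Fact (1 ≤ (n : ℝ≥0∞)) := ⟨by exact_mod_cast hn⟩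
  let F : XX d → C(XX d, XX d) := fun y => ⟨fun z => z - y, by fun_prop⟩
  have hF : Continuous F := ContinuousMap.continuous_of_continuous_uncurry _ (by
    simp only [F, Function.uncurry_def, ContinuousMap.coe_mk]; fun_prop)
  have hFm : ∀ y, MeasurePreserving (F y) (volume : Measure (XX d)) volume :=
    fun y => measurePreserving_sub_right volume y
  have hc := Continuous.compMeasurePreservingLp (continuous_const (y := hg.toLp g)) hF hFm (by simp)
  have h0 := EMetric.continuousAt_iff.1 (hc.continuousAt (x := (0 : XX d))) ε (pos_iff_ne_zero.2 hε)
  obtain ⟨ρ, hρ, h⟩ := h0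
  obtain ⟨r, hr, hr2⟩ : ∃ r : ℝ, 0 < r ∧ ENNReal.ofReal r < ρ := by
    obtain ⟨r, h1, h2⟩ := ENNReal.lt_iff_exists_real_btwn.1 hρ
    exact ⟨r, by simpa using h2.1, h2.2⟩
  refine ⟨r, hr, fun y hy => ?_⟩
  have h1 := h (x := y) (by
    rw [edist_zero_right, ← ofReal_norm]
    exact (ENNReal.ofReal_lt_ofReal_iff hr |>.2 hy).trans hr2)
  simp only [Lp.toLp_compMeasurePreserving] at h1
  rw [Lp.edist_toLp_toLp] at h1
  refine le_trans (le_of_eq ?_) h1.le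
  congr 1
  funext z
  simp [F]

lemma jensen_pow {α : Type*} [MeasurableSpace α] {ν : Measure α} {n : ℕ} (hn : 1 ≤ n) {φ h : α → ℝ}
    (hφ : ∀ y, 0 ≤ φ y) (hφm : Measurable φ) (hφi : ∫⁻ y, ENNReal.ofReal (φ y) ∂ν = 1)
    (hh : Measurable h) :
    ‖∫ y, φ y * h y ∂ν‖ₑ ^ n ≤ ∫⁻ y, ENNReal.ofReal (φ y) * ‖h y‖ₑ ^ n ∂ν := by
  set m := ν.withDensity (fun y => ENNReal.ofReal (φ y)) with hm
  have hφm' : Measurable fun y => ENNReal.ofReal (φ y) := hφm.ennreal_ofReal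
  have : IsProbabilityMeasure m := ⟨by simp [hm, hφi]⟩
  have h1 : ‖∫ y, φ y * h y ∂ν‖ₑ ≤ ∫⁻ y, ‖h y‖ₑ ∂m := by
    refine (enorm_integral_le_lintegral_enorm _).trans (le_of_eq ?_)
    rw [hm, lintegral_withDensity_eq_lintegral_mul _ hφm' hh.enorm]
    refine lintegral_congr fun y => ?_
    simp [Real.enorm_of_nonneg (hφ y)]
  have hn0 : (0:ℝ) < n := by exact_mod_cast hn
  have h2 := eLpNorm'_le_eLpNorm'_of_exponent_le (p := 1) (q := n) one_pos (by exact_mod_cast hn) m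
    hh.aestronglyMeasurable
  simp only [eLpNorm', ENNReal.rpow_one, div_one] at h2
  have h3 := (h1.trans h2)
  calc _ ≤ ((∫⁻ y, ‖h y‖ₑ ^ (n:ℝ) ∂m) ^ (1 / (n:ℝ))) ^ n := by gcongr
    _ = ∫⁻ y, ‖h y‖ₑ ^ (n:ℝ) ∂m := by
      rw [← ENNReal.rpow_natCast, ← ENNReal.rpow_mul, one_div_mul_cancel hn0.ne', ENNReal.rpow_one]
    _ = _ := by
      rw [hm, lintegral_withDensity_eq_lintegral_mul _ hφm' (by fun_prop)]
      simp

open scoped Convolution in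
def moll {d : ℕ} (φ : ContDiffBump (0 : XX d)) (g : XX d → ℝ) : XX d → ℝ :=
  φ.normed volume ⋆[ContinuousLinearMap.lsmul ℝ ℝ, volume] g

lemma moll_apply {d : ℕ} (φ : ContDiffBump (0 : XX d)) (g : XX d → ℝ) (z : XX d) :
    moll φ g z = ∫ y, φ.normed volume y * g (z - y) := by
  simp [moll, convolution]

lemma moll_integrable {d : ℕ} (φ : ContDiffBump (0 : XX d)) {g : XX d → ℝ}
    (hg : LocallyIntegrable g volume) (z : XX d) :
    Integrable (fun y => φ.normed volume y * g (z - y)) volume := by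
  have := φ.hasCompactSupport_normed.convolutionExists_left (ContinuousLinearMap.lsmul ℝ ℝ)
    (φ.continuous_normed (μ := volume)) hg z
  simpa [ConvolutionExistsAt] using this

lemma moll_Lq {d n : ℕ} (hn : 1 ≤ n) {g : XX d → ℝ} (hgm : Measurable g) (hg : MemLp g n volume)
    {ε : ℝ≥0∞} (hε : ε ≠ 0) :
    ∃ ρ > (0:ℝ), ∀ φ : ContDiffBump (0 : XX d), φ.rOut < ρ →
      eLpNorm (fun z => moll φ g z - g z) n volume ≤ ε := by
  obtain ⟨ρ, hρ, h⟩ := transl_cont hn hg hε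
  have hn1 : (1 : ℝ≥0∞) ≤ n := by exact_mod_cast hn
  have hn0 : (n : ℝ≥0∞) ≠ 0 := by positivity
  have hn0' : (0:ℝ) < n := by exact_mod_cast hn
  have hgl : LocallyIntegrable g volume := hg.locallyIntegrable hn1
  refine ⟨ρ, hρ, fun φ hφ => ?_⟩
  have hφm : Measurable (φ.normed (volume : Measure (XX d))) := φ.continuous_normed.measurable
  have hφi : ∫⁻ y, ENNReal.ofReal (φ.normed (volume : Measure (XX d)) y) = 1 := by
    rw [← ofReal_integral_eq_lintegral_ofReal φ.integrable_normed (.of_forall φ.nonneg_normed),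
      φ.integral_normed, ENNReal.ofReal_one]
  have h1 : ∀ z, ‖moll φ g z - g z‖ₑ ^ n ≤
      ∫⁻ y, ENNReal.ofReal (φ.normed volume y) * ‖g (z - y) - g z‖ₑ ^ n := by
    intro z
    have e : moll φ g z - g z = ∫ y, φ.normed volume y * (g (z - y) - g z) := by
      simp_rw [mul_sub]
      rw [integral_sub (moll_integrable φ hgl z) (φ.integrable_normed.mul_const _), moll_apply,
        integral_mul_const, φ.integral_normed, one_mul]
    rw [e]
    exact jensen_pow hn φ.nonneg_normed hφm hφi (by fun_prop)
  have hpow : ∀ f : XX d → ℝ, eLpNorm f n volume ^ n = ∫⁻ z, ‖f z‖ₑ ^ n := by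
    intro f
    rw [eLpNorm_eq_lintegral_rpow_enorm_toReal hn0 (by simp)]
    simp only [ENNReal.toReal_natCast]
    rw [← ENNReal.rpow_natCast, ← ENNReal.rpow_mul, one_div_mul_cancel hn0'.ne', ENNReal.rpow_one]
    simp
  have key : eLpNorm (fun z => moll φ g z - g z) n volume ^ n ≤ ε ^ n := by
    rw [hpow]
    calc _ ≤ ∫⁻ z, ∫⁻ y, ENNReal.ofReal (φ.normed volume y) * ‖g (z - y) - g z‖ₑ ^ n := lintegral_mono h1
      _ = ∫⁻ y, ∫⁻ z, ENNReal.ofReal (φ.normed volume y) * ‖g (z - y) - g z‖ₑ ^ n := by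
        rw [lintegral_lintegral_swap]
        refine Measurable.aemeasurable ?_
        fun_prop
      _ = ∫⁻ y, ENNReal.ofReal (φ.normed volume y) * ∫⁻ z, ‖g (z - y) - g z‖ₑ ^ n := by
        refine lintegral_congr fun y => ?_
        rw [lintegral_const_mul]
        fun_prop
      _ ≤ ∫⁻ y, ENNReal.ofReal (φ.normed volume y) * ε ^ n := by
        refine lintegral_mono fun y => ?_
        by_cases hy : ‖y‖ < ρ
        · have := h y hy
          rw [← hpow]
          gcongr
        · have : φ.normed volume y = 0 := by
            have : y ∉ Function.support (φ.normed (volume : Measure (XX d))) := by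
              rw [φ.support_normed_eq]
              simp; linarith
            simpa using this
          simp [this]
      _ = ε ^ n := by
        rw [lintegral_mul_const _ hφm.ennreal_ofReal, hφi, one_mul]
  exact (ENNReal.pow_le_pow_left_iff (by omega)).1 key

lemma moll_contDiff {d : ℕ} (φ : ContDiffBump (0 : XX d)) {g : XX d → ℝ}
    (hg : LocallyIntegrable g volume) : ContDiff ℝ (⊤ : ℕ∞) (moll φ g) :=
  φ.hasCompactSupport_normed.contDiff_convolution_left _ φ.contDiff_normed hg

lemma moll_fderiv {d : ℕ} (φ : ContDiffBump (0 : XX d)) {g g' : XX d → ℝ} {G : Set (XX d)}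
    (hg : LocallyIntegrable g volume) (hg' : LocallyIntegrable g' volume) {v : XX d}
    (hl : ∀ z ∈ G, HasLineDerivAt ℝ g (g' z) z v) {z : XX d} (hz : Metric.closedBall z φ.rOut ⊆ G) :
    fderiv ℝ (moll φ g) z v = moll φ g' z := by
  have h1 := (φ.hasCompactSupport_normed.hasFDerivAt_convolution_left (ContinuousLinearMap.lsmul ℝ ℝ)
    (φ.contDiff_normed (μ := volume)) hg z).fderiv
  have hex := (φ.hasCompactSupport_normed.fderiv (𝕜 := ℝ)).convolutionExists_left
    ((ContinuousLinearMap.lsmul ℝ ℝ).precompL (XX d)) ((φ.contDiff_normed (μ := volume) (n := 1)).continuous_fderiv (by simp)) hg z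
  rw [moll, h1, convolution, ContinuousLinearMap.integral_apply hex]
  simp only [ContinuousLinearMap.precompL_apply, ContinuousLinearMap.lsmul_apply, smul_eq_mul]
  have hintg : Integrable (fun y => fderiv ℝ (φ.normed volume) y v * g (z - y)) volume := by
    have := hex.integrable.apply_continuousLinearMap v
    simpa using this
  have := integral_bilinear_hasLineDerivAt_right_eq_neg_left_of_integrable (μ := volume)
    (B := ContinuousLinearMap.mul ℝ ℝ) (f := φ.normed volume) (f' := fun y => fderiv ℝ (φ.normed volume) y v)
    (g := fun y => g (z - y)) (g' := fun y => - g' (z - y)) (v := v) ?_ ?_ ?_ ?_ ?_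
  · simp only [ContinuousLinearMap.mul_apply', mul_neg, integral_neg, neg_inj] at this
    rw [moll_apply, this]
  · simpa using hintg
  · simpa using (moll_integrable φ hg' z).neg
  · simpa using moll_integrable φ hg z
  · intro y _
    exact ((φ.contDiff_normed (μ := volume) (n := 1)).differentiable (by simp)).differentiableAt.hasFDerivAt.hasLineDerivAt v
  · intro y hy
    rw [φ.tsupport_normed_eq] at hy
    have := hl (z - y) (hz (by simpa [dist_eq_norm] using hy))
    have h2 : HasDerivAt (fun t : ℝ => g (z - y + t • v)) (g' (z - y)) (-0) := by simpa [HasLineDerivAt] using this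
    have h3 := h2.scomp (0:ℝ) (hasDerivAt_neg (0:ℝ))
    simp only [HasLineDerivAt]
    convert! h3 using 1
    · funext t
      simp [Function.comp]; congr 1; abel
    · simp

lemma abp_smooth {d : ℕ} {δ : ℝ} (hδ : 0 < δ) {w : XX d → ℝ} (hw : ContDiff ℝ (⊤ : ℕ∞) w)
    (a : XX d → Matrix (Fin d) (Fin d) ℝ)
    (ha : ∀ z (ξ : EE d), δ * ‖ξ‖ ^ 2 ≤ ∑ i, ∑ j, a z i j * ξ i * ξ j)
    {D : Set (XX d)} (hD : IsCompact D) {r B : ℝ} (hr : 0 < r) {z1 : XX d} (hz1 : z1 ∈ D)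
    (hwz1 : 3 * B / 8 ≤ w z1) (hDr : ∀ z ∈ D, ‖z.2 - z1.2‖ ≤ r)
    (hfw : ∀ z ∈ D, B / 8 < w z → ∃ η > 0, ∀ z' : XX d, z.1 ≤ z'.1 → z'.1 < z.1 + η →
      ‖z'.2 - z.2‖ < η → z' ∈ D) {H : XX d → ℝ}
    (hH : ∀ z ∈ D, B / 8 ≤ w z → ‖gradx w z‖ ≤ B / (8 * r) →
      -fderiv ℝ w z (et d) - ∑ i, ∑ j, a z i j * hessx w z i j ≤ H z) :
    ENNReal.ofReal (δ ^ d) * volume ((Ioo (B / 4) (3 * B / 8)) ×ˢ (Metric.ball (0 : EE d) (B / (8 * r)))) ≤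
      ∫⁻ z in D, ENNReal.ofReal (H z) ^ (d + 1) := by
  set C : Set (XX d) := D ∩ {z | fderiv ℝ w z (et d) ≤ 0} ∩
    {z | ∀ ξ : EE d, ∑ i, ∑ j, hessx w z i j * ξ i * ξ j ≤ 0} ∩ {z | B / 8 ≤ w z} ∩
    {z | ‖gradx w z‖ ≤ B / (8 * r)} with hC
  have hh : ∀ i j, Continuous fun z => hessx w z i j := by
    intro i j
    exact (contDiff_pd (contDiff_pd hw (ex i)) (ex j)).continuous
  have hCc : IsClosed C := by
    refine ((((hD.isClosed.inter ?_).inter ?_).inter ?_).inter ?_)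
    · exact isClosed_le (contDiff_pd hw _).continuous continuous_const
    · simp only [ofPred_forall]
      refine isClosed_iInter fun ξ => isClosed_le ?_ continuous_const
      exact continuous_finsetSum _ fun i _ => continuous_finsetSum _ fun j _ =>
        ((hh i j).mul continuous_const).mul continuous_const
    · exact isClosed_le continuous_const hw.continuous
    · exact isClosed_le (contDiff_gradx hw).continuous.norm continuous_const
  have h1 := tso_measure hδ hw z1.2 a ha hCc.measurableSet (fun z hz => hz.1.1.1.2)
    (fun z hz => hessx_psd hw z hz.1.1.2)
  have hsub : (Ioo (B / 4) (3 * B / 8)) ×ˢ (Metric.ball (0 : EE d) (B / (8 * r))) ⊆ tsoMap w z1.2 '' C := by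
    rintro ⟨h, p⟩ ⟨hh, hp⟩
    obtain ⟨z, hzD, e1, e2, e3, e4, e5⟩ := contact_exists hw hD hr (x1 := z1.2) (p := p) (h := h) hh.1
      (by simpa using hp) hz1 rfl (hh.2.trans_le hwz1) hDr hfw
    exact ⟨z, ⟨⟨⟨⟨hzD, e2⟩, e3⟩, e4⟩, e5⟩, e1⟩
  calc _ ≤ ENNReal.ofReal (δ ^ d) * volume (tsoMap w z1.2 '' C) := by gcongr
    _ ≤ _ := h1
    _ ≤ ∫⁻ z in C, ENNReal.ofReal (H z) ^ (d + 1) := by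
      refine setLIntegral_mono_ae' hCc.measurableSet (.of_forall fun z hz => ?_)
      have := hH z hz.1.1.1.1 hz.1.2 hz.2
      gcongr
    _ ≤ _ := lintegral_mono_set fun z hz => hz.1.1.1.1

def bmp (d k : ℕ) : ContDiffBump (0 : XX d) where
  rIn := 1 / (2 * ((k:ℝ) + 1))
  rOut := 1 / ((k:ℝ) + 1)
  rIn_pos := by positivity
  rIn_lt_rOut := by
    apply one_div_lt_one_div_of_lt <;> nlinarith [(Nat.cast_nonneg k : (0:ℝ) ≤ k)]

lemma ev_bmp {d : ℕ} {p : ContDiffBump (0 : XX d) → Prop} (h : ∃ ρ > (0:ℝ), ∀ φ, φ.rOut < ρ → p φ) :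
    ∀ᶠ k in Filter.atTop, p (bmp d k) := by
  obtain ⟨ρ, hρ, h⟩ := h
  have := (tendsto_order.1 (tendsto_one_div_add_atTop_nhds_zero_nat (𝕜 := ℝ))).2 ρ hρ
  filter_upwards [this] with k hk
  exact h _ hk

lemma abp_core {d : ℕ} {δ Ka : ℝ} (hδ : 0 < δ) (hKa0 : 0 ≤ Ka)
    (a : XX d → Matrix (Fin d) (Fin d) ℝ)
    (ha : ∀ z (ξ : EE d), δ * ‖ξ‖ ^ 2 ≤ ∑ i, ∑ j, a z i j * ξ i * ξ j)
    (hKa : ∀ z i j, |a z i j| ≤ Ka)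
    {U Ut : XX d → ℝ} {dU : Fin d → XX d → ℝ} {d2U : Fin d → Fin d → XX d → ℝ}
    (hUm : Measurable U) (hUtm : Measurable Ut) (hdUm : ∀ i, Measurable (dU i))
    (hd2Um : ∀ i j, Measurable (d2U i j))
    (hUp : MemLp U ((d + 1 : ℕ)) volume) (hUtp : MemLp Ut ((d + 1 : ℕ)) volume)
    (hdUp : ∀ i, MemLp (dU i) ((d + 1 : ℕ)) volume)
    (hd2Up : ∀ i j, MemLp (d2U i j) ((d + 1 : ℕ)) volume)
    {G : Set (XX d)} (hG : IsOpen G)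
    (hlt : ∀ z ∈ G, HasLineDerivAt ℝ U (Ut z) z (et d))
    (hl1 : ∀ i, ∀ z ∈ G, HasLineDerivAt ℝ U (dU i z) z (ex i))
    (hl2 : ∀ i j, ∀ z ∈ G, HasLineDerivAt ℝ (dU i) (d2U i j z) z (ex j))
    (hUc : ContinuousOn U G)
    {D : Set (XX d)} (hD : IsCompact D) (hDG : D ⊆ G) {P : XX d → ℝ} (hP : ContDiff ℝ (⊤ : ℕ∞) P)
    {r B M : ℝ} (hr : 0 < r) (hB : 0 < B) (hM : 0 ≤ M)
    {z1 : XX d} (hz1 : z1 ∈ D)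
    (hwz1 : B / 2 ≤ U z1 - P z1) (hDr : ∀ z ∈ D, ‖z.2 - z1.2‖ ≤ r)
    (hfw : ∀ z ∈ D, 0 < U z - P z → ∃ η > 0, ∀ z' : XX d, z.1 ≤ z'.1 → z'.1 < z.1 + η →
      ‖z'.2 - z.2‖ < η → z' ∈ D) {F : XX d → ℝ} (hFm : Measurable F) (hF0 : ∀ z, 0 ≤ F z)
    (hH : ∀ z ∈ D, 0 < U z - P z →
      -(Ut z - fderiv ℝ P z (et d)) - ∑ i, ∑ j, a z i j * (d2U i j z - hessx P z i j) ≤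
        F z + M * (‖(WithLp.toLp 2 (fun i => dU i z) : EE d) - gradx P z‖ - B / (8 * r))) :
    ENNReal.ofReal (δ ^ d) * volume ((Ioo (B / 4) (3 * B / 8)) ×ˢ (Metric.ball (0 : EE d) (B / (8 * r)))) ≤
      ∫⁻ z in D, ENNReal.ofReal (F z) ^ (d + 1) := by
  have hn1 : (1 : ℝ≥0∞) ≤ (d + 1 : ℕ) := by exact_mod_cast Nat.le_add_left 1 d
  have lU := hUp.locallyIntegrable hn1
  have lUt := hUtp.locallyIntegrable hn1
  have ldU := fun i => (hdUp i).locallyIntegrable hn1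
  have ld2U := fun i j => (hd2Up i j).locallyIntegrable hn1
  obtain ⟨ρ0, hρ0, hρG⟩ := hD.exists_cthickening_subset_open hG hDG
  -- reduction to approximate statement
  set S : ℝ≥0∞ := eLpNorm F (d + 1 : ℕ) (volume.restrict D) with hS
  set X : ℝ≥0∞ := ENNReal.ofReal (δ ^ d) * volume ((Ioo (B / 4) (3 * B / 8)) ×ˢ (Metric.ball (0 : EE d) (B / (8 * r)))) with hX
  have hpow : ∀ f : XX d → ℝ, eLpNorm f (d + 1 : ℕ) (volume.restrict D) ^ (d + 1) = ∫⁻ z in D, ‖f z‖ₑ ^ (d + 1) := by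
    intro f
    rw [eLpNorm_eq_lintegral_rpow_enorm_toReal (by positivity) (by simp)]
    simp only [ENNReal.toReal_natCast]
    rw [← ENNReal.rpow_natCast, ← ENNReal.rpow_mul, one_div_mul_cancel (by positivity), ENNReal.rpow_one]
    simp [← ENNReal.rpow_natCast]
  have hgoal : X ≤ S ^ (d + 1) → X ≤ ∫⁻ z in D, ENNReal.ofReal (F z) ^ (d + 1) := by
    intro h
    rw [hS, hpow] at h
    refine h.trans (le_of_eq (lintegral_congr fun z => ?_))
    rw [Real.enorm_of_nonneg (hF0 z)]
  apply hgoal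
  -- the constant
  set T : ℝ := 1 + Ka * (d * d) + M * d with hT
  have hT0 : 0 < T := by positivity
  have main : ∀ ε : NNReal, 0 < ε → X ≤ (S + ENNReal.ofReal T * ε) ^ (d + 1) := by
    intro ε hε
    have hε' : (ε : ℝ≥0∞) ≠ 0 := by exact_mod_cast hε.ne'
    have v1 := ev_bmp (moll_Lq (by omega) hUtm hUtp hε')
    have v2 := Filter.eventually_all.2 fun i => ev_bmp (moll_Lq (by omega) (hdUm i) (hdUp i) hε')
    have v3 := Filter.eventually_all.2 fun i => Filter.eventually_all.2 fun j =>
      ev_bmp (moll_Lq (by omega) (hd2Um i j) (hd2Up i j) hε')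
    have v4 : ∀ᶠ k in Filter.atTop, (bmp d k).rOut < ρ0 / 2 :=
      ev_bmp (p := fun φ => φ.rOut < ρ0 / 2) ⟨ρ0 / 2, by positivity, fun φ h => h⟩
    have v5 : ∀ᶠ k in Filter.atTop, ∀ z ∈ D, dist (moll (bmp d k) U z) (U z) ≤ B / 16 := by
      have hc : IsCompact (Metric.cthickening ρ0 D) := hD.cthickening
      have huc := hc.uniformContinuousOn_of_continuous (hUc.mono hρG)
      obtain ⟨η, hη, hη2⟩ := Metric.uniformContinuousOn_iff.1 huc (B / 16) (by positivity)
      refine ev_bmp (p := fun φ => ∀ z ∈ D, dist (moll φ U z) (U z) ≤ B / 16)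
        ⟨min η ρ0, lt_min hη hρ0, fun φ hφ z hz => ?_⟩
      refine ContDiffBump.dist_normed_convolution_le hUm.aestronglyMeasurable fun x hx => ?_
      have hx' : dist x z < min η ρ0 := (Metric.mem_ball.1 hx).trans hφ
      refine (hη2 x ?_ z (Metric.self_subset_cthickening D hz) (hx'.trans_le (min_le_left _ _))).le
      exact Metric.mem_cthickening_of_dist_le x z ρ0 D hz ((hx'.trans_le (min_le_right _ _)).le)
    obtain ⟨k, k1, k2, k3, k4, k5⟩ := (v1.and (v2.and (v3.and (v4.and v5)))).exists
    set φ := bmp d k with hφ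
    have hball : ∀ z ∈ D, ∀ y, dist y z < ρ0 / 2 → Metric.closedBall y φ.rOut ⊆ G := by
      intro z hz y hy x hx
      apply hρG
      refine Metric.mem_cthickening_of_dist_le x z ρ0 D hz ?_
      have := dist_triangle x y z
      have h2 := Metric.mem_closedBall.1 hx
      linarith
    have hball0 : ∀ z ∈ D, Metric.closedBall z φ.rOut ⊆ G := fun z hz => hball z hz z (by simp; positivity)
    set V := moll φ U with hV
    have hVs : ContDiff ℝ (⊤ : ℕ∞) V := moll_contDiff φ lU
    have hVt : ∀ z ∈ D, fderiv ℝ V z (et d) = moll φ Ut z := fun z hz => moll_fderiv φ lU lUt hlt (hball0 z hz)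
    have hV1 : ∀ z ∈ D, ∀ i, ∀ᶠ y in nhds z, fderiv ℝ V y (ex i) = moll φ (dU i) y := by
      intro z hz i
      filter_upwards [Metric.ball_mem_nhds z (show 0 < ρ0 / 2 by positivity)] with y hy
      exact moll_fderiv φ lU (ldU i) (hl1 i) (hball z hz y hy)
    have hV2 : ∀ z ∈ D, ∀ i j, hessx V z i j = moll φ (d2U i j) z := by
      intro z hz i j
      have h1 : fderiv ℝ (fun y => fderiv ℝ V y (ex i)) z = fderiv ℝ (moll φ (dU i)) z :=
        Filter.EventuallyEq.fderiv_eq (hV1 z hz i)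
      simp only [hessx, Matrix.of_apply, h1]
      exact moll_fderiv φ (ldU i) (ld2U i j) (hl2 i j) (hball0 z hz)
    set w : XX d → ℝ := fun z => V z - P z with hw
    have hws : ContDiff ℝ (⊤ : ℕ∞) w := hVs.sub hP
    have hwd : ∀ z v, fderiv ℝ w z v = fderiv ℝ V z v - fderiv ℝ P z v := by
      intro z v
      have := fderiv_fun_sub (hVs.differentiable (by simp)).differentiableAt (x := z)
        (hP.differentiable (by simp)).differentiableAt
      rw [hw, this]; rfl
    have hwh : ∀ z i j, hessx w z i j = hessx V z i j - hessx P z i j := by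
      intro z i j
      have := fderiv_fun_sub ((contDiff_pd hVs (ex i)).differentiable (by simp)).differentiableAt (x := z)
        ((contDiff_pd hP (ex i)).differentiable (by simp)).differentiableAt
      simp only [hessx, Matrix.of_apply, hwd, this]; rfl
    set e : XX d → ℝ := fun z => |moll φ Ut z - Ut z| + Ka * ∑ i, ∑ j, |moll φ (d2U i j) z - d2U i j z|
      + M * ∑ i, |moll φ (dU i) z - dU i z| with he
    have hwU : ∀ z ∈ D, |w z - (U z - P z)| ≤ B / 16 := by
      intro z hz
      have := k5 z hz
      rw [Real.dist_eq] at this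
      simpa [hw] using this
    have hsm := abp_smooth hδ hws a ha hD hr hz1 (B := B) (H := fun z => F z + e z) ?_ hDr ?_ ?_
    · refine hsm.trans ?_
      have c1 : ∀ g : XX d → ℝ, Measurable g → LocallyIntegrable g volume → Measurable fun z => moll φ g z - g z :=
        fun g h1 h2 => (moll_contDiff φ h2).continuous.measurable.sub h1
      have m1 : Measurable fun z => |moll φ Ut z - Ut z| := (c1 _ hUtm lUt).abs
      have m2 : ∀ i j, Measurable fun z => |moll φ (d2U i j) z - d2U i j z| :=
        fun i j => (c1 _ (hd2Um i j) (ld2U i j)).abs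
      have m3 : ∀ i, Measurable fun z => |moll φ (dU i) z - dU i z| := fun i => (c1 _ (hdUm i) (ldU i)).abs
      have m2' : Measurable fun z => ∑ i, ∑ j, |moll φ (d2U i j) z - d2U i j z| :=
        Finset.measurable_fun_sum _ fun i _ => Finset.measurable_fun_sum _ fun j _ => m2 i j
      have m3' : Measurable fun z => ∑ i, |moll φ (dU i) z - dU i z| :=
        Finset.measurable_fun_sum _ fun i _ => m3 i
      have he0 : ∀ z, 0 ≤ e z := fun z => by positivity
      have hem : Measurable e := (m1.add (m2'.const_mul _)).add (m3'.const_mul _)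
      have nb : ∀ g : XX d → ℝ, eLpNorm (fun z => moll φ g z - g z) (d + 1 : ℕ) volume ≤ ε →
          eLpNorm (fun z => |moll φ g z - g z|) (d + 1 : ℕ) volume ≤ ε := by
        intro g hg
        refine le_trans (le_of_eq ?_) hg
        exact eLpNorm_norm (fun z => moll φ g z - g z)
      have en : eLpNorm e (d + 1 : ℕ) volume ≤ ENNReal.ofReal T * ε := by
        have s1 : eLpNorm (fun z => ∑ i, ∑ j, |moll φ (d2U i j) z - d2U i j z|) (d + 1 : ℕ) volume ≤
            d * (d * ε) := by
          have := eLpNorm_sum_le (s := Finset.univ) (f := fun i : Fin d => fun z => ∑ j, |moll φ (d2U i j) z - d2U i j z|)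
            (μ := volume) (p := (d + 1 : ℕ)) (fun i _ => (Finset.measurable_fun_sum _ fun j _ => m2 i j).aestronglyMeasurable) hn1
          simp only [Finset.sum_fn] at this
          refine this.trans ?_
          refine (Finset.sum_le_card_nsmul _ _ (d * (ε : ℝ≥0∞)) fun i _ => ?_).trans (by simp)
          have := eLpNorm_sum_le (s := Finset.univ) (f := fun j : Fin d => fun z => |moll φ (d2U i j) z - d2U i j z|)
            (μ := volume) (p := (d + 1 : ℕ)) (fun j _ => (m2 i j).aestronglyMeasurable) hn1
          simp only [Finset.sum_fn] at this
          refine this.trans ?_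
          exact (Finset.sum_le_card_nsmul _ _ (ε : ℝ≥0∞) fun j _ => nb _ (k3 i j)).trans (by simp)
        have s2 : eLpNorm (fun z => ∑ i, |moll φ (dU i) z - dU i z|) (d + 1 : ℕ) volume ≤ d * ε := by
          have := eLpNorm_sum_le (s := Finset.univ) (f := fun j : Fin d => fun z => |moll φ (dU j) z - dU j z|)
            (μ := volume) (p := (d + 1 : ℕ)) (fun j _ => (m3 j).aestronglyMeasurable) hn1
          simp only [Finset.sum_fn] at this
          refine this.trans ?_
          exact (Finset.sum_le_card_nsmul _ _ (ε : ℝ≥0∞) fun j _ => nb _ (k2 j)).trans (by simp)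
        have t1 := eLpNorm_add_le ((m1.add (m2'.const_mul Ka))).aestronglyMeasurable (m3'.const_mul M).aestronglyMeasurable
          (μ := volume) hn1
        have t2 := eLpNorm_add_le m1.aestronglyMeasurable (m2'.const_mul Ka).aestronglyMeasurable
          (μ := volume) hn1
        have t3 := eLpNorm_const_smul_le (c := Ka) (f := fun z => ∑ i, ∑ j, |moll φ (d2U i j) z - d2U i j z|) (p := (d + 1 : ℕ)) (μ := volume)
        have t4 := eLpNorm_const_smul_le (c := M) (f := fun z => ∑ i, |moll φ (dU i) z - dU i z|) (p := (d + 1 : ℕ)) (μ := volume)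
        refine (t1.trans (add_le_add (t2.trans (add_le_add (nb _ k1) (t3.trans (mul_le_mul_right s1 _)))) (t4.trans (mul_le_mul_right s2 _)))).trans (le_of_eq ?_)
        rw [hT, ENNReal.ofReal_add (by positivity) (by positivity), ENNReal.ofReal_add (by positivity) (by positivity),
          ENNReal.ofReal_mul hKa0, ENNReal.ofReal_mul hM, ENNReal.ofReal_mul (by positivity),
          Real.enorm_of_nonneg hKa0, Real.enorm_of_nonneg hM]
        simp only [ENNReal.ofReal_natCast, ENNReal.ofReal_one]
        ring
      have t5 := eLpNorm_add_le (hFm.aestronglyMeasurable (μ := volume.restrict D)) hem.aestronglyMeasurable hn1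
      have t6 : eLpNorm (F + e) (d + 1 : ℕ) (volume.restrict D) ≤ S + ENNReal.ofReal T * ε := by
        refine t5.trans (add_le_add le_rfl ((eLpNorm_mono_measure _ Measure.restrict_le_self).trans en))
      calc ∫⁻ z in D, ENNReal.ofReal (F z + e z) ^ (d + 1) = eLpNorm (F + e) (d + 1 : ℕ) (volume.restrict D) ^ (d + 1) := by
            rw [hpow]
            refine lintegral_congr fun z => ?_
            rw [Pi.add_apply, Real.enorm_of_nonneg (add_nonneg (hF0 z) (he0 z))]
        _ ≤ _ := by gcongr
    · have := abs_le.1 (hwU z1 hz1)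
      linarith
    · intro z hz hBw
      refine hfw z hz ?_
      have := abs_le.1 (hwU z hz)
      linarith
    · intro z hz hBw hgw
      have h0 : 0 < U z - P z := by
        have := abs_le.1 (hwU z hz)
        linarith
      have h1 := hH z hz h0
      have hg : gradx w z = (WithLp.toLp 2 (fun i => moll φ (dU i) z) : EE d) - gradx P z := by
        ext i
        simp [gradx, hwd, (hV1 z hz i).self_of_nhds]
      have hnorm : ‖(WithLp.toLp 2 (fun i => dU i z) : EE d) - gradx P z‖ ≤
          B / (8 * r) + ∑ i, |moll φ (dU i) z - dU i z| := by
        have e1 : (WithLp.toLp 2 (fun i => dU i z) : EE d) - gradx P z =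
            gradx w z - ∑ i, (moll φ (dU i) z - dU i z) • EuclideanSpace.single i (1:ℝ) := by
          rw [hg]
          ext j
          simp [Pi.single_apply]
        rw [e1]
        refine (norm_sub_le _ _).trans (add_le_add hgw ((norm_sum_le _ _).trans ?_))
        refine Finset.sum_le_sum fun i _ => ?_
        simp [norm_smul]
      have h2 : M * (‖(WithLp.toLp 2 (fun i => dU i z) : EE d) - gradx P z‖ - B / (8 * r)) ≤
          M * ∑ i, |moll φ (dU i) z - dU i z| := by
        refine mul_le_mul_of_nonneg_left ?_ hM
        linarith
      have h3 : -∑ i, ∑ j, a z i j * hessx w z i j ≤ -(∑ i, ∑ j, a z i j * (d2U i j z - hessx P z i j)) +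
          Ka * ∑ i, ∑ j, |moll φ (d2U i j) z - d2U i j z| := by
        rw [Finset.mul_sum, ← Finset.sum_neg_distrib, ← Finset.sum_neg_distrib, ← Finset.sum_add_distrib]
        refine Finset.sum_le_sum fun i _ => ?_
        rw [Finset.mul_sum, ← Finset.sum_neg_distrib, ← Finset.sum_neg_distrib, ← Finset.sum_add_distrib]
        refine Finset.sum_le_sum fun j _ => ?_
        rw [hwh, hV2 z hz]
        have q1 : |a z i j * (moll φ (d2U i j) z - d2U i j z)| ≤ Ka * |moll φ (d2U i j) z - d2U i j z| := by
          rw [abs_mul]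
          exact mul_le_mul_of_nonneg_right (hKa z i j) (abs_nonneg _)
        have q2 := neg_abs_le (a z i j * (moll φ (d2U i j) z - d2U i j z))
        linarith
      have h4 : -fderiv ℝ w z (et d) ≤ -(Ut z - fderiv ℝ P z (et d)) + |moll φ Ut z - Ut z| := by
        rw [hwd, hVt z hz]
        have := neg_abs_le (moll φ Ut z - Ut z)
        linarith
      simp only [he]
      linarith
  -- conclusion
  by_cases hStop : S = ∞
  · rw [hStop]; simp
  have hlim : Filter.Tendsto (fun k : ℕ => (S + ENNReal.ofReal T * ((1 / ((k:NNReal) + 1) : NNReal) : ℝ≥0∞)) ^ (d + 1)) Filter.atTop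
      (nhds ((S + ENNReal.ofReal T * ((0 : NNReal) : ℝ≥0∞)) ^ (d + 1))) := by
    have l0 : Filter.Tendsto (fun k : ℕ => ((1 / ((k:NNReal) + 1) : NNReal) : ℝ≥0∞)) Filter.atTop (nhds ((0:NNReal) : ℝ≥0∞)) :=
      ENNReal.tendsto_coe.2 tendsto_one_div_add_atTop_nhds_zero_nat
    exact ENNReal.Tendsto.pow ((ENNReal.Tendsto.const_mul l0 (Or.inr (by simp))).const_add S)
  simp only [ENNReal.coe_zero, mul_zero, add_zero] at hlim
  exact ge_of_tendsto' hlim fun k => main _ (by positivity)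

lemma exit_point {d : ℕ} {Q : Set (XX d)} (hQ : IsOpen Q) {z z' : XX d} (hz : z ∈ Q) (hz' : z' ∉ Q)
    (ht : z.1 < z'.1) : ∃ y ∈ segment ℝ z z', y ∈ parabolicBoundary Q := by
  set γ : ℝ → XX d := fun s => z + s • (z' - z) with hγ
  have hγc : Continuous γ := by fun_prop
  set A : Set ℝ := Icc 0 1 ∩ γ ⁻¹' Qᶜ with hA
  have hAc : IsCompact A := isCompact_Icc.inter_right (hQ.isClosed_compl.preimage hγc)
  have hAn : A.Nonempty := ⟨1, ⟨by norm_num, by norm_num⟩, by simpa [hγ] using hz'⟩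
  obtain ⟨s, hs, hmin⟩ := hAc.exists_isLeast hAn
  have hs0 : 0 < s := by
    refine lt_of_le_of_ne hs.1.1 fun h => ?_
    have := hs.2
    rw [← h] at this
    simp [hγ] at this
    exact this hz
  have hlt : ∀ s', 0 ≤ s' → s' < s → γ s' ∈ Q := by
    intro s' h0 h1
    by_contra hcon
    have := hmin (show s' ∈ A from ⟨⟨h0, h1.le.trans hs.1.2⟩, hcon⟩)
    linarith
  have hcl : γ s ∈ closure Q := by
    have h1 : Filter.Tendsto γ (nhdsWithin s (Iio s)) (nhds (γ s)) :=
      (hγc.tendsto s).mono_left nhdsWithin_le_nhds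
    refine mem_closure_of_tendsto h1 ?_
    filter_upwards [Ioo_mem_nhdsLT hs0] with s' hs'
    exact hlt s' hs'.1.le hs'.2
  have hτ : 0 < z'.1 - z.1 := by linarith
  refine ⟨γ s, ?_, ⟨hcl, ?_⟩, s * (z'.1 - z.1), by positivity,
    fun t => z.2 + ((t - z.1) / (z'.1 - z.1)) • (z'.2 - z.2), ?_, ?_, ?_⟩
  · rw [segment_eq_image']
    exact ⟨s, hs.1, rfl⟩
  · rw [hQ.interior_eq]; exact hs.2
  · exact Continuous.continuousOn (by fun_prop)
  · simp only [hγ, Prod.fst_add, Prod.smul_fst, Prod.fst_sub, smul_eq_mul, Prod.snd_add, Prod.smul_snd, Prod.snd_sub]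
    congr 2
    field_simp; ring
  · intro t ht'
    simp only [hγ, Prod.fst_add, Prod.smul_fst, Prod.fst_sub, smul_eq_mul, mem_Ico] at ht'
    have h0 : 0 ≤ (t - z.1) / (z'.1 - z.1) := div_nonneg (by linarith [ht'.1]) hτ.le
    have h1 : (t - z.1) / (z'.1 - z.1) < s := by rw [div_lt_iff₀ hτ]; linarith [ht'.2]
    convert hlt _ h0 h1 using 1
    ext1
    · simp [hγ]; field_simp; ring
    · simp [hγ]

lemma domain_D {d : ℕ} {Q : Set (XX d)} (hQ : IsOpen Q) {u : XX d → ℝ} (huc : ContinuousOn u (closure Q))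
    (hub : ∀ z ∈ parabolicBoundary Q, u z ≤ 0) {z1 : XX d} (hz1 : z1 ∈ Q) {ε r T : ℝ} (hε : 0 < ε)
    (hr : 0 < r) (hT : 0 < T) (hu1 : 2 * ε ≤ u z1) :
    ∃ D : Set (XX d), IsCompact D ∧ D ⊆ Q ∧ z1 ∈ D ∧ (∀ z ∈ D, z1.1 ≤ z.1 ∧ ‖z.2 - z1.2‖ ≤ r ∧ z.1 ≤ z1.1 + T) ∧
      ∀ z ∈ D, 2 * ε ≤ u z → z.1 < z1.1 + T → ‖z.2 - z1.2‖ < r →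
        ∃ η > 0, ∀ z' : XX d, z.1 ≤ z'.1 → z'.1 < z.1 + η → ‖z'.2 - z.2‖ < η → z' ∈ D := by
  set R := T + r + 4 with hR
  set K0 := closure Q ∩ Metric.closedBall z1 R with hK0
  have hK0c : IsCompact K0 := (isCompact_closedBall z1 R).inter_left isClosed_closure
  have huK : ContinuousOn u K0 := huc.mono inter_subset_left
  obtain ⟨ρ', hρ', hmod'⟩ := Metric.uniformContinuousOn_iff.1 (hK0c.uniformContinuousOn_of_continuous huK) (ε / 2) (by positivity)
  obtain ⟨ρ, hρ, hρ1, hmod⟩ : ∃ ρ > 0, ρ ≤ 1 ∧ ∀ x ∈ K0, ∀ y ∈ K0, dist x y < ρ → |u x - u y| < ε / 2 :=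
    ⟨min ρ' 1, lt_min hρ' one_pos, min_le_right _ _, fun x hx y hy h => by
      rw [← Real.dist_eq]; exact hmod' x hx y hy (h.trans_le (min_le_left _ _))⟩
  -- star property
  have star : ∀ z ∈ closure Q, dist z z1 ≤ T + r + 2 → ε ≤ u z → ∀ z', z.1 < z'.1 → dist z' z < ρ / 2 → z' ∈ Q := by
    intro z hz hzd hzu z' ht hd
    by_contra hz'
    have hopen : IsOpen (Metric.ball z (ρ / 2) ∩ {y : XX d | y.1 < z'.1}) :=
      Metric.isOpen_ball.inter (isOpen_lt continuous_fst continuous_const)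
    obtain ⟨y, ⟨hyb, hyt⟩, hyQ⟩ := mem_closure_iff.1 hz _ hopen ⟨Metric.mem_ball_self (by positivity), ht⟩
    obtain ⟨x, hxs, hxb⟩ := exit_point hQ hyQ hz' hyt
    have hyb : dist y z < ρ / 2 := hyb
    have d1 : dist x z < ρ / 2 := by
      have := (convex_ball z (ρ / 2)).segment_subset (x := y) (y := z') hyb hd hxs
      exact this
    have hzK : z ∈ K0 := ⟨hz, by rw [Metric.mem_closedBall]; linarith⟩
    have hxK : x ∈ K0 := ⟨frontier_subset_closure hxb.1, by
      rw [Metric.mem_closedBall]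
      have := dist_triangle x z z1
      linarith⟩
    have h1 := hmod x hxK z hzK (by linarith)
    have h2 := hub x hxb
    rw [abs_lt] at h1
    linarith
  obtain ⟨σ1, hσ1, hσ1Q⟩ := Metric.isOpen_iff.1 hQ z1 hz1
  set σ := min (ρ / 4) (σ1 / 2) with hσ
  have hσ0 : 0 < σ := lt_min (by positivity) (by positivity)
  have hσρ : σ ≤ ρ / 4 := min_le_left _ _
  have hσσ : σ < σ1 := (min_le_right _ _).trans_lt (by linarith)
  set sh : XX d → XX d := fun z => z - σ • et d with hsh
  have hshc : Continuous sh := by fun_prop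
  have hsh1 : ∀ z, (sh z).1 = z.1 - σ := fun z => by simp [hsh, et]
  have hsh2 : ∀ z, (sh z).2 = z.2 := fun z => by simp [hsh, et]
  have hshd : ∀ z, dist (sh z) z = σ := fun z => by
    rw [Prod.dist_eq, hsh1, hsh2]; simp [abs_of_pos hσ0, hσ0.le]
  have hshdd : ∀ z z', dist (sh z) (sh z') = dist z z' := fun z z' => by simp [hsh]
  have hS : IsCompact (K0 ∩ u ⁻¹' Ici ε) :=
    hK0c.of_isClosed_subset (huK.preimage_isClosed_of_isClosed hK0c.isClosed isClosed_Ici) inter_subset_left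
  set D : Set (XX d) := {z | z1.1 ≤ z.1 ∧ z.1 ≤ z1.1 + T ∧ ‖z.2 - z1.2‖ ≤ r} ∩ sh ⁻¹' (K0 ∩ u ⁻¹' Ici ε) with hD
  have hcyl : ∀ z ∈ {z : XX d | z1.1 ≤ z.1 ∧ z.1 ≤ z1.1 + T ∧ ‖z.2 - z1.2‖ ≤ r}, dist z z1 ≤ T + r := by
    rintro z ⟨h1, h2, h3⟩
    rw [Prod.dist_eq, max_le_iff, Real.dist_eq, dist_eq_norm, abs_of_nonneg (by linarith)]
    constructor <;> linarith
  have hDcl : IsClosed D := by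
    refine IsClosed.inter ?_ (hS.isClosed.preimage hshc)
    refine (isClosed_le continuous_const continuous_fst).inter ((isClosed_le continuous_fst continuous_const).inter
      (isClosed_le (continuous_snd.sub continuous_const).norm continuous_const))
  have hDQ : D ⊆ Q := by
    rintro z ⟨hz, ⟨hz2, hz3⟩, hz4⟩
    refine star (sh z) hz2 ?_ hz4 z (by rw [hsh1]; linarith) (by rw [dist_comm, hshd]; linarith)
    have := dist_triangle (sh z) z z1
    have := hcyl z hz
    have := hshd z
    linarith
  refine ⟨D, ?_, hDQ, ?_, fun z hz => ⟨hz.1.1, hz.1.2.2, hz.1.2.1⟩, ?_⟩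
  · refine (isCompact_closedBall z1 (T + r)).of_isClosed_subset hDcl fun z hz => hcyl z hz.1
  · have hq : sh z1 ∈ Q := hσ1Q (by rw [Metric.mem_ball, hshd]; exact hσσ)
    have hk : sh z1 ∈ K0 := ⟨subset_closure hq, by rw [Metric.mem_closedBall, hshd]; linarith⟩
    refine ⟨⟨le_rfl, by linarith, by simpa using hr.le⟩, hk, ?_⟩
    have hk1 : z1 ∈ K0 := ⟨subset_closure hz1, Metric.mem_closedBall_self (by positivity)⟩
    have := hmod _ hk _ hk1 (by rw [hshd]; linarith)
    rw [abs_lt] at this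
    show ε ≤ u (sh z1)
    linarith
  · intro z hz huz hzT hzr
    have hzc := hcyl z hz.1
    refine ⟨min (ρ / 4) (min (z1.1 + T - z.1) (r - ‖z.2 - z1.2‖)), lt_min (by positivity) (lt_min (by linarith) (by linarith)), ?_⟩
    intro z' h1 h2 h3
    have e1 := min_le_left (ρ / 4) (min (z1.1 + T - z.1) (r - ‖z.2 - z1.2‖))
    have e2 := (min_le_right (ρ / 4) (min (z1.1 + T - z.1) (r - ‖z.2 - z1.2‖))).trans (min_le_left _ _)
    have e3 := (min_le_right (ρ / 4) (min (z1.1 + T - z.1) (r - ‖z.2 - z1.2‖))).trans (min_le_right _ _)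
    have hcz' : z' ∈ {z : XX d | z1.1 ≤ z.1 ∧ z.1 ≤ z1.1 + T ∧ ‖z.2 - z1.2‖ ≤ r} := by
      refine ⟨hz.1.1.trans h1, by linarith, ?_⟩
      have : z'.2 - z1.2 = (z'.2 - z.2) + (z.2 - z1.2) := by abel
      rw [this]
      have := norm_add_le (z'.2 - z.2) (z.2 - z1.2)
      linarith
    have hd' : dist z' z < ρ / 4 := by
      rw [Prod.dist_eq, max_lt_iff, Real.dist_eq, dist_eq_norm, abs_of_nonneg (by linarith)]
      constructor <;> linarith
    have hzK : z ∈ K0 := ⟨subset_closure (hDQ hz), by rw [Metric.mem_closedBall]; linarith⟩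
    have hsu := hmod _ hz.2.1 _ hzK (by rw [hshd]; linarith)
    rw [abs_lt] at hsu
    have hshz1 : dist (sh z) z1 ≤ T + r + 2 := by
      have := dist_triangle (sh z) z z1
      have := hshd z
      linarith
    have hlater : ∀ s, 0 < s → s < ρ / 4 → sh (z' + s • et d) ∈ Q := by
      intro s hs0 hs
      refine star (sh z) hz.2.1.1 hshz1 hz.2.2 _ ?_ ?_
      · rw [hsh1, hsh1]; simp [et]; linarith
      · rw [hshdd]
        have t1 := dist_triangle (z' + s • et d) z' z
        have t2 : dist (z' + s • et d) z' = s := by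
          simp [et, Prod.norm_def, abs_of_pos hs0, hs0.le]
        linarith
    have hcl : sh z' ∈ closure Q := by
      have hcont : Continuous fun s : ℝ => sh (z' + s • et d) := by fun_prop
      have ht : Filter.Tendsto (fun s : ℝ => sh (z' + s • et d)) (nhdsWithin 0 (Ioi 0)) (nhds (sh (z' + (0:ℝ) • et d))) :=
        (hcont.tendsto 0).mono_left nhdsWithin_le_nhds
      rw [zero_smul, add_zero] at ht
      refine mem_closure_of_tendsto ht ?_
      filter_upwards [Ioo_mem_nhdsGT (show 0 < ρ / 4 by positivity)] with s hs
      exact hlater s hs.1 hs.2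
    have hk' : sh z' ∈ K0 := by
      refine ⟨hcl, ?_⟩
      rw [Metric.mem_closedBall]
      have := dist_triangle (sh z') z' z1
      have := hshd z'
      have := hcyl z' hcz'
      linarith
    refine ⟨hcz', hk', ?_⟩
    have := hmod _ hk' _ hz.2.1 (by rw [hshdd]; linarith)
    rw [abs_lt] at this
    show ε ≤ u (sh z')
    linarith

def quadP {d : ℕ} (α0 α1 α2 β1 β2 : ℝ) (z0 z1 : XX d) (z : XX d) : ℝ :=
  α0 + α1 * (z.1 - z0.1) ^ 2 + α2 * ‖z.2 - z0.2‖ ^ 2 + β1 * (z.1 - z1.1) + β2 * ‖z.2 - z1.2‖ ^ 2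

lemma quadP_contDiff {d : ℕ} (α0 α1 α2 β1 β2 : ℝ) (z0 z1 : XX d) :
    ContDiff ℝ (⊤ : ℕ∞) (quadP α0 α1 α2 β1 β2 z0 z1) := by
  unfold quadP
  have h1 : ContDiff ℝ (⊤ : ℕ∞) fun z : XX d => ‖z.2 - z0.2‖ ^ 2 := (contDiff_snd.sub contDiff_const).norm_sq ℝ
  have h2 : ContDiff ℝ (⊤ : ℕ∞) fun z : XX d => ‖z.2 - z1.2‖ ^ 2 := (contDiff_snd.sub contDiff_const).norm_sq ℝ
  fun_prop

lemma quadP_fderiv {d : ℕ} (α0 α1 α2 β1 β2 : ℝ) (z0 z1 z v : XX d) :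
    fderiv ℝ (quadP α0 α1 α2 β1 β2 z0 z1) z v = 2 * α1 * (z.1 - z0.1) * v.1 +
      2 * α2 * inner ℝ (z.2 - z0.2) v.2 + β1 * v.1 + 2 * β2 * inner ℝ (z.2 - z1.2) v.2 := by
  have hd := ((quadP_contDiff α0 α1 α2 β1 β2 z0 z1).differentiable (by simp)).differentiableAt (x := z)
  have h1 : HasDerivAt (fun s : ℝ => quadP α0 α1 α2 β1 β2 z0 z1 (z + s • v))
      (fderiv ℝ (quadP α0 α1 α2 β1 β2 z0 z1) z v) 0 := hd.hasFDerivAt.hasLineDerivAt v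
  refine h1.unique ?_
  have e : (fun s : ℝ => quadP α0 α1 α2 β1 β2 z0 z1 (z + s • v)) = fun s : ℝ =>
      quadP α0 α1 α2 β1 β2 z0 z1 z + s * (2 * α1 * (z.1 - z0.1) * v.1 +
      2 * α2 * inner ℝ (z.2 - z0.2) v.2 + β1 * v.1 + 2 * β2 * inner ℝ (z.2 - z1.2) v.2)
      + s ^ 2 * (α1 * v.1 ^ 2 + α2 * ‖v.2‖ ^ 2 + β2 * ‖v.2‖ ^ 2) := by
    funext s
    have n : ∀ y : EE d, ‖z.2 + s • v.2 - y‖ ^ 2 = ‖z.2 - y‖ ^ 2 + 2 * s * inner ℝ (z.2 - y) v.2 + s ^ 2 * ‖v.2‖ ^ 2 := by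
      intro y
      rw [show z.2 + s • v.2 - y = (z.2 - y) + s • v.2 by abel, norm_add_sq_real, inner_smul_right, norm_smul]
      rw [mul_pow, Real.norm_eq_abs, sq_abs]; ring
    simp only [quadP, Prod.snd_add, Prod.smul_snd, Prod.fst_add, Prod.smul_fst, smul_eq_mul, n]
    ring
  rw [e]
  have h2 := (((hasDerivAt_id (0:ℝ)).mul_const (2 * α1 * (z.1 - z0.1) * v.1 +
      2 * α2 * inner ℝ (z.2 - z0.2) v.2 + β1 * v.1 + 2 * β2 * inner ℝ (z.2 - z1.2) v.2)).const_add
      (quadP α0 α1 α2 β1 β2 z0 z1 z)).add ((hasDerivAt_pow 2 (0:ℝ)).mul_const (α1 * v.1 ^ 2 + α2 * ‖v.2‖ ^ 2 + β2 * ‖v.2‖ ^ 2))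
  convert! h2 using 1
  simp

lemma quadP_gradx {d : ℕ} (α0 α1 α2 β1 β2 : ℝ) (z0 z1 z : XX d) :
    gradx (quadP α0 α1 α2 β1 β2 z0 z1) z = (2 * α2) • (z.2 - z0.2) + (2 * β2) • (z.2 - z1.2) := by
  ext i
  simp [gradx, quadP_fderiv, ex, EuclideanSpace.inner_single_right]

lemma quadP_hessx {d : ℕ} (α0 α1 α2 β1 β2 : ℝ) (z0 z1 z : XX d) (i j : Fin d) :
    hessx (quadP α0 α1 α2 β1 β2 z0 z1) z i j = if i = j then 2 * α2 + 2 * β2 else 0 := by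
  have : (fun y => fderiv ℝ (quadP α0 α1 α2 β1 β2 z0 z1) y (ex i)) =
      fun y => innerSL ℝ (EuclideanSpace.single i (1:ℝ)) y.2 * (2 * α2 + 2 * β2) - (2 * α2 * z0.2 i + 2 * β2 * z1.2 i) := by
    funext y
    simp [quadP_fderiv, ex, EuclideanSpace.inner_single_right, EuclideanSpace.inner_single_left]
    ring
  simp only [hessx, Matrix.of_apply, this]
  have h : HasFDerivAt (fun y : XX d => innerSL ℝ (EuclideanSpace.single i (1:ℝ)) y.2 * (2 * α2 + 2 * β2) - (2 * α2 * z0.2 i + 2 * β2 * z1.2 i))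
    ((2 * α2 + 2 * β2) • ((innerSL ℝ (EuclideanSpace.single i (1:ℝ))).comp (ContinuousLinearMap.snd ℝ ℝ (EE d)))) z := by
    refine HasFDerivAt.sub_const _ (HasFDerivAt.mul_const ?_ _)
    exact ((innerSL ℝ (EuclideanSpace.single i (1:ℝ))).comp (ContinuousLinearMap.snd ℝ ℝ (EE d))).hasFDerivAt
  rw [h.fderiv]
  by_cases hij : i = j
  · subst hij; simp [ex]
  · simp [ex, hij, EuclideanSpace.inner_single_left]

lemma entry_bound {d : ℕ} {δ K : ℝ} (hδ : 0 < δ) (A : Matrix (Fin d) (Fin d) ℝ) (hs : A.IsSymm)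
    (ha : ∀ ξ : EE d, δ * ‖ξ‖ ^ 2 ≤ ∑ i, ∑ j, A i j * ξ i * ξ j) (ht : A.trace + 1 ≤ K) (i j : Fin d) :
    |A i j| ≤ K := by
  have hd : ∀ i, 0 ≤ A i i := by
    intro i
    have := ha (EuclideanSpace.single i 1)
    simp [Pi.single_apply] at this
    linarith
  have htr : ∀ i, A i i ≤ K := by
    intro i
    have : A i i ≤ A.trace := Finset.single_le_sum (f := fun i => A i i) (fun i _ => hd i) (Finset.mem_univ i)
    linarith
  have hq : ∀ s : ℝ, 0 ≤ A i i + s * A i j + s * A j i + s ^ 2 * A j j := by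
    intro s
    have h := (mul_nonneg hδ.le (sq_nonneg _)).trans (ha (EuclideanSpace.single i 1 + s • EuclideanSpace.single j 1))
    simp [Pi.single_apply, mul_add, add_mul, Finset.sum_add_distrib] at h
    nlinarith
  have e : A j i = A i j := hs.apply i j
  have h1 := hq 1
  have h2 := hq (-1)
  rw [e] at h1 h2
  have := htr i
  have := htr j
  rw [abs_le]; constructor <;> linarith

lemma memLp_ind {d : ℕ} {G : Set (XX d)} (hG : IsOpen G) {g S : XX d → ℝ} (hg : Measurable g)
    (hS : IntegrableOn S G volume) (h : ∀ z, |g z| ^ ((d:ℝ) + 1) ≤ S z) :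
    MemLp (G.indicator g) ((d + 1 : ℕ)) volume := by
  rw [memLp_indicator_iff_restrict hG.measurableSet]
  have hn0 : ((d + 1 : ℕ) : ℝ≥0∞) ≠ 0 := by positivity
  rw [← integrable_norm_rpow_iff hg.aestronglyMeasurable hn0 (by simp)]
  refine Integrable.mono' hS ?_ ?_
  · exact (hg.norm.pow_const _).aestronglyMeasurable
  · refine .of_forall fun z => ?_
    simp only [ENNReal.toReal_natCast, Nat.cast_add, Nat.cast_one, Real.norm_eq_abs]
    rw [abs_of_nonneg (by positivity)]
    exact h z

lemma line_ind {d : ℕ} {G : Set (XX d)} (hG : IsOpen G) {g : XX d → ℝ} {c : ℝ} {z v : XX d} (hz : z ∈ G)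
    (h : HasDerivAt (fun s : ℝ => g (z + s • v)) c 0) : HasLineDerivAt ℝ (G.indicator g) c z v := by
  refine HasDerivAt.congr_of_eventuallyEq h ?_
  have hc : Continuous fun s : ℝ => z + s • v := by fun_prop
  have : ∀ᶠ s in nhds (0:ℝ), z + s • v ∈ G := hc.continuousAt.eventually_mem (by simpa using hG.mem_nhds hz)
  filter_upwards [this] with s hs
  simp [hs]

structure PDat {d : ℕ} (δ K M μ : ℝ) (a : XX d → Matrix (Fin d) (Fin d) ℝ) (b : XX d → EE d) (c : XX d → ℝ)
    (Q : Set (XX d)) (u ut : XX d → ℝ) (du : XX d → EE d) (d2u : XX d → Matrix (Fin d) (Fin d) ℝ) : Prop where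
  δ0 : 0 < δ
  K1 : 1 ≤ K
  M0 : 0 < M
  μ0 : 0 < μ
  μM : μ ≤ (K + 1) * M ^ 2
  am : ∀ i j, Measurable fun z => a z i j
  bm : ∀ i, Measurable fun z => b z i
  cm : Measurable c
  symm : ∀ z, (a z).IsSymm
  ell : ∀ z (ξ : EE d), δ * ‖ξ‖ ^ 2 ≤ ∑ i, ∑ j, a z i j * ξ i * ξ j
  tr : ∀ z, Matrix.trace (a z) + 1 ≤ K
  bM : ∀ z, ‖b z‖ ≤ M
  c0 : ∀ z, 0 ≤ c z
  Qo : IsOpen Q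
  um : Measurable u
  utm : Measurable ut
  dum : ∀ i, Measurable fun z => du z i
  d2um : ∀ i j, Measurable fun z => d2u z i j
  dt : ∀ z ∈ Q, HasDerivAt (fun s => u (s, z.2)) (ut z) z.1
  dx : ∀ z ∈ Q, ∀ i,
          HasDerivAt (fun s : ℝ => u (z.1, z.2 + s • EuclideanSpace.single i (1 : ℝ))) (du z i) 0
  dxx : ∀ z ∈ Q, ∀ i j,
          HasDerivAt (fun s : ℝ => du (z.1, z.2 + s • EuclideanSpace.single j (1 : ℝ)) i)
            (d2u z i j) 0
  int : ∀ G : Set (XX d), IsOpen G → Bornology.IsBounded G → G ⊆ Q →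
          IntegrableOn (fun z => |u z| ^ ((d : ℝ) + 1) + |ut z| ^ ((d : ℝ) + 1) +
            ‖du z‖ ^ ((d : ℝ) + 1) + frobNorm (d2u z) ^ ((d : ℝ) + 1)) G volume
  uc : ContinuousOn u (closure Q)
  ub : ∃ M : ℝ, ∀ z ∈ closure Q, |u z| ≤ M
  bd : ∀ z ∈ parabolicBoundary Q, u z ≤ 0

def ffun {d : ℕ} (μ : ℝ) (a : XX d → Matrix (Fin d) (Fin d) ℝ) (b : XX d → EE d) (c : XX d → ℝ)
    (u ut : XX d → ℝ) (du : XX d → EE d) (d2u : XX d → Matrix (Fin d) (Fin d) ℝ) (z : XX d) : ℝ :=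
  max (μ * u z - (ut z + (∑ i, ∑ j, a z i j * d2u z i j) + (∑ i, b z i * du z i) - c z * u z)) 0

/-- the weight -/
def phiw {d : ℕ} (K M μ : ℝ) (y : XX d) : ℝ :=
  1 + (μ / (8 * (K + 1))) ^ 2 * y.1 ^ 2 + (μ / (8 * (K + 1)) / M) ^ 2 * ‖y.2‖ ^ 2

lemma scalar_ineq {K M μ c lam eta τ X φ V B tr u : ℝ} (hK : 1 ≤ K) (hM : 0 < M) (hμ : 0 < μ)
    (hμM : μ ≤ (K + 1) * M ^ 2) (hc : c * (8 * (K + 1)) = 1) (hlam : lam = c * μ) (heta : eta * M = c * μ)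
    (hφ : φ = 1 + lam ^ 2 * τ ^ 2 + eta ^ 2 * X ^ 2) (hV : 0 < V) (hB : 0 ≤ B) (htr : tr ≤ K)
    (hBV : B * (5 + 3 * K) * M ^ 2 ≤ μ * V * φ / 2) (hu : V * φ - B ≤ u) :
    2 * V * lam ^ 2 * τ + B * M ^ 2 + (2 * V * eta ^ 2 + 2 * B * M ^ 2) * tr + 2 * V * eta ^ 2 * M * X
      + 2 * B * M ^ 2 - μ * u ≤ - (B * M ^ 2 / 8) := by
  have hK1 : 0 < K + 1 := by linarith
  have hc0 : 0 < c := by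
    by_contra h
    push Not at h
    have := mul_nonpos_of_nonpos_of_nonneg h (by linarith : 0 ≤ 8 * (K + 1))
    linarith
  have hc16 : c ≤ 1 / 16 := by nlinarith
  have hlam0 : 0 < lam := by rw [hlam]; positivity
  have heta0 : 0 < eta := by
    by_contra h
    push Not at h
    have := mul_nonpos_of_nonpos_of_nonneg h hM.le
    have := mul_pos hc0 hμ
    linarith
  have hφ1 : 1 ≤ φ := by rw [hφ]; nlinarith [sq_nonneg (lam * τ), sq_nonneg (eta * X)]
  have s1 : 2 * lam ^ 2 * τ ≤ c * μ * φ := by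
    have : 2 * (lam * τ) ≤ φ := by rw [hφ]; nlinarith [sq_nonneg (lam * τ - 1), sq_nonneg (eta * X)]
    calc 2 * lam ^ 2 * τ = lam * (2 * (lam * τ)) := by ring
      _ ≤ lam * φ := by gcongr
      _ = _ := by rw [hlam]
  have s2 : 2 * eta ^ 2 * M * X ≤ c * μ * φ := by
    have : 2 * (eta * X) ≤ φ := by rw [hφ]; nlinarith [sq_nonneg (eta * X - 1), sq_nonneg (lam * τ)]
    calc 2 * eta ^ 2 * M * X = (eta * M) * (2 * (eta * X)) := by ring
      _ ≤ (eta * M) * φ := by gcongr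
      _ = _ := by rw [heta]
  have s3 : eta ^ 2 ≤ c ^ 2 * μ * (K + 1) := by
    have h1 : eta ^ 2 * M ^ 2 ≤ c ^ 2 * μ * (K + 1) * M ^ 2 := by
      have : eta ^ 2 * M ^ 2 = c ^ 2 * μ * μ := by rw [← mul_pow, heta]; ring
      rw [this]
      have : 0 ≤ c ^ 2 * μ := by positivity
      nlinarith
    exact le_of_mul_le_mul_right h1 (by positivity)
  have s4 : 2 * eta ^ 2 * tr ≤ μ / 32 * φ := by
    have h1 : 2 * eta ^ 2 * tr ≤ 2 * eta ^ 2 * K := by gcongr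
    have h2 : 2 * eta ^ 2 * K ≤ 2 * (c ^ 2 * μ * (K + 1)) * K := by gcongr
    have h3 : 2 * (c ^ 2 * μ * (K + 1)) * K = c * K * μ / 4 := by
      have : c * (K + 1) = 1 / 8 := by linarith
      calc _ = 2 * c * μ * K * (c * (K + 1)) := by ring
        _ = _ := by rw [this]; ring
    have h4 : c * K ≤ 1 / 8 := by linarith
    have h5 : c * K * μ / 4 ≤ μ / 32 := by nlinarith
    have h6 : μ / 32 ≤ μ / 32 * φ := by nlinarith
    linarith
  have s5 : 2 * B * M ^ 2 * tr ≤ 2 * B * M ^ 2 * K := by gcongr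
  have s6 : μ * B ≤ (K + 1) * M ^ 2 * B := by gcongr
  have s7 : μ * (V * φ - B) ≤ μ * u := by gcongr
  have hμφ : 0 < μ * φ := by positivity
  have s8 : c * μ * φ ≤ μ * φ / 16 := by nlinarith
  have s9 : V * (2 * lam ^ 2 * τ + 2 * eta ^ 2 * M * X + 2 * eta ^ 2 * tr) ≤ V * (μ * φ / 2) := by
    apply mul_le_mul_of_nonneg_left _ hV.le
    linarith
  have s10 : 0 ≤ B * M ^ 2 := by positivity
  linarith

lemma phiw_pos {d : ℕ} (K M μ : ℝ) (y : XX d) : 1 ≤ phiw K M μ y := by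
  unfold phiw
  nlinarith [mul_nonneg (sq_nonneg (μ / (8 * (K + 1)))) (sq_nonneg y.1),
    mul_nonneg (sq_nonneg (μ / (8 * (K + 1)) / M)) (sq_nonneg ‖y.2‖)]

lemma phiw_comp {d : ℕ} {K M μ : ℝ} (hK : 1 ≤ K) (hM : 0 < M) (hμ : 0 < μ)
    (hμM : μ ≤ (K + 1) * M ^ 2) {y y' : XX d} (h1 : |y.1 - y'.1| ≤ 1 / M ^ 2) (h2 : ‖y.2 - y'.2‖ ≤ 1 / M) :
    phiw K M μ y ≤ 2 * phiw K M μ y' := by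
  unfold phiw
  set lam := μ / (8 * (K + 1)) with hlam
  have hK1 : 0 < K + 1 := by linarith
  have hlam0 : 0 < lam := by positivity
  have hl : lam / M ^ 2 ≤ 1 / 8 := by
    rw [hlam, div_div, div_le_div_iff₀ (by positivity) (by norm_num)]
    nlinarith
  have ha : lam * |y.1 - y'.1| ≤ 1 / 8 := by
    calc _ ≤ lam * (1 / M ^ 2) := by gcongr
      _ = lam / M ^ 2 := by ring
      _ ≤ _ := hl
  have hb : lam / M * ‖y.2 - y'.2‖ ≤ 1 / 8 := by
    calc _ ≤ lam / M * (1 / M) := by gcongr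
      _ = lam / M ^ 2 := by field_simp
      _ ≤ _ := hl
  have t1 : lam * |y.1| ≤ lam * |y'.1| + 1 / 8 := by
    have : |y.1| ≤ |y'.1| + |y.1 - y'.1| := by
      have := abs_add_le y'.1 (y.1 - y'.1)
      simpa using this
    nlinarith
  have t2 : lam / M * ‖y.2‖ ≤ lam / M * ‖y'.2‖ + 1 / 8 := by
    have h3 : ‖y.2‖ ≤ ‖y'.2‖ + ‖y.2 - y'.2‖ := by
      have := norm_add_le y'.2 (y.2 - y'.2)
      simpa using this
    have h4 : 0 < lam / M := by positivity
    nlinarith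
  have q : ∀ s t : ℝ, 0 ≤ s → 0 ≤ t → s ≤ t + 1 / 8 → s ^ 2 ≤ 3 / 2 * t ^ 2 + 3 / 64 := by
    intro s t h0 h0' h
    have h1 : s ^ 2 ≤ (t + 1 / 8) ^ 2 := by gcongr
    nlinarith [sq_nonneg (t - 1 / 4)]
  have q1 := q _ _ (by positivity) (by positivity) t1
  have q2 := q _ _ (by positivity) (by positivity) t2
  rw [mul_pow, mul_pow, sq_abs, sq_abs] at q1
  rw [mul_pow, mul_pow] at q2
  linarith [mul_nonneg (sq_nonneg lam) (sq_nonneg y'.1), mul_nonneg (sq_nonneg (lam / M)) (sq_nonneg ‖y'.2‖)]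

lemma ffun_measurable {d : ℕ} {δ K M μ : ℝ} {a : XX d → Matrix (Fin d) (Fin d) ℝ} {b : XX d → EE d} {c : XX d → ℝ}
    {Q : Set (XX d)} {u ut : XX d → ℝ} {du : XX d → EE d} {d2u : XX d → Matrix (Fin d) (Fin d) ℝ}
    (h : PDat δ K M μ a b c Q u ut du d2u) : Measurable (ffun μ a b c u ut du d2u) := by
  have h1 : Measurable fun z => ∑ i, ∑ j, a z i j * d2u z i j :=
    Finset.measurable_fun_sum _ fun i _ => Finset.measurable_fun_sum _ fun j _ => (h.am i j).mul (h.d2um i j)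
  have h2 : Measurable fun z => ∑ i, b z i * du z i :=
    Finset.measurable_fun_sum _ fun i _ => (h.bm i).mul (h.dum i)
  exact ((h.um.const_mul μ).sub (((h.utm.add h1).add h2).sub (h.cm.mul h.um))).max measurable_const

lemma frob_entry {d : ℕ} (m : Matrix (Fin d) (Fin d) ℝ) (i j : Fin d) : |m i j| ≤ frobNorm m := by
  unfold frobNorm
  apply Real.abs_le_sqrt
  calc (m i j) ^ 2 ≤ ∑ j, (m i j) ^ 2 := Finset.single_le_sum (f := fun j => (m i j) ^ 2) (fun j _ => sq_nonneg _) (Finset.mem_univ j)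
    _ ≤ _ := Finset.single_le_sum (f := fun i => ∑ j, (m i j) ^ 2) (fun i _ => Finset.sum_nonneg fun j _ => sq_nonneg _) (Finset.mem_univ i)

/-- application of the ABP core estimate on a subset of `Q` -/
lemma abp_app {d : ℕ} {δ K M μ : ℝ} {a : XX d → Matrix (Fin d) (Fin d) ℝ} {b : XX d → EE d} {c : XX d → ℝ}
    {Q : Set (XX d)} {u ut : XX d → ℝ} {du : XX d → EE d} {d2u : XX d → Matrix (Fin d) (Fin d) ℝ}
    (h : PDat δ K M μ a b c Q u ut du d2u)
    {D : Set (XX d)} (hD : IsCompact D) (hDQ : D ⊆ Q) {P : XX d → ℝ} (hP : ContDiff ℝ (⊤ : ℕ∞) P)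
    {r B : ℝ} (hr : 0 < r) (hB : 0 < B)
    {z1 : XX d} (hz1 : z1 ∈ D)
    (hwz1 : B / 2 ≤ u z1 - P z1) (hDr : ∀ z ∈ D, ‖z.2 - z1.2‖ ≤ r)
    (hfw : ∀ z ∈ D, 0 < u z - P z → ∃ η > 0, ∀ z' : XX d, z.1 ≤ z'.1 → z'.1 < z.1 + η →
      ‖z'.2 - z.2‖ < η → z' ∈ D)
    (hH : ∀ z ∈ D, 0 < u z - P z →
      -(ut z - fderiv ℝ P z (et d)) - ∑ i, ∑ j, a z i j * (d2u z i j - hessx P z i j) ≤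
        ffun μ a b c u ut du d2u z + M * (‖du z - gradx P z‖ - B / (8 * r))) :
    ENNReal.ofReal (δ ^ d) * volume ((Ioo (B / 4) (3 * B / 8)) ×ˢ (Metric.ball (0 : EE d) (B / (8 * r)))) ≤
      ∫⁻ z in D, ENNReal.ofReal (ffun μ a b c u ut du d2u z) ^ (d + 1) := by
  obtain ⟨R, hR⟩ := hD.isBounded.subset_ball z1
  set G := Q ∩ Metric.ball z1 R with hG
  have hGo : IsOpen G := h.Qo.inter Metric.isOpen_ball
  have hGb : Bornology.IsBounded G := Metric.isBounded_ball.subset inter_subset_right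
  have hGQ : G ⊆ Q := inter_subset_left
  have hDG : D ⊆ G := subset_inter hDQ hR
  have hintg := h.int G hGo hGb hGQ
  have hind : ∀ (g : XX d → ℝ), ∀ z ∈ G, G.indicator g z = g z := fun g z hz => indicator_of_mem hz g
  have hfn : ∀ z, 0 ≤ frobNorm (d2u z) := fun z => Real.sqrt_nonneg _
  refine abp_core (U := G.indicator u) (Ut := G.indicator ut) (dU := fun i => G.indicator fun z => du z i)
    (d2U := fun i j => G.indicator fun z => d2u z i j) (Ka := K) h.δ0 (by linarith [h.K1]) a h.ell
    (fun z i j => entry_bound h.δ0 (a z) (h.symm z) (h.ell z) (h.tr z) i j)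
    (h.um.indicator hGo.measurableSet) (h.utm.indicator hGo.measurableSet)
    (fun i => (h.dum i).indicator hGo.measurableSet) (fun i j => (h.d2um i j).indicator hGo.measurableSet)
    (memLp_ind hGo h.um hintg fun z => ?_) (memLp_ind hGo h.utm hintg fun z => ?_)
    (fun i => memLp_ind hGo (h.dum i) hintg fun z => ?_) (fun i j => memLp_ind hGo (h.d2um i j) hintg fun z => ?_)
    hGo ?_ ?_ ?_ ?_ hD hDG hP hr hB h.M0.le hz1 ?_ hDr ?_ (ffun_measurable h) (fun z => le_max_right _ _) ?_
  · have := hfn z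
    have : 0 ≤ |ut z| ^ ((d : ℝ) + 1) + ‖du z‖ ^ ((d : ℝ) + 1) + frobNorm (d2u z) ^ ((d : ℝ) + 1) := by positivity
    linarith
  · have := hfn z
    have : 0 ≤ |u z| ^ ((d : ℝ) + 1) + ‖du z‖ ^ ((d : ℝ) + 1) + frobNorm (d2u z) ^ ((d : ℝ) + 1) := by positivity
    linarith
  · have := hfn z
    have : 0 ≤ |u z| ^ ((d : ℝ) + 1) + |ut z| ^ ((d : ℝ) + 1) + frobNorm (d2u z) ^ ((d : ℝ) + 1) := by positivity
    have h2 : |du z i| ≤ ‖du z‖ := PiLp.norm_apply_le (du z) i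
    have h3 : |du z i| ^ ((d : ℝ) + 1) ≤ ‖du z‖ ^ ((d : ℝ) + 1) := by gcongr
    linarith
  · have : 0 ≤ |u z| ^ ((d : ℝ) + 1) + |ut z| ^ ((d : ℝ) + 1) + ‖du z‖ ^ ((d : ℝ) + 1) := by positivity
    have h2 := frob_entry (d2u z) i j
    have h3 : |d2u z i j| ^ ((d : ℝ) + 1) ≤ frobNorm (d2u z) ^ ((d : ℝ) + 1) := by gcongr
    linarith
  · intro z hz
    rw [hind ut z hz]
    refine line_ind hGo hz ?_
    have h1 : HasDerivAt (fun s => u (s, z.2)) (ut z) (z.1 + 0) := by simpa using h.dt z (hGQ hz)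
    have h2 := h1.comp_const_add z.1 0
    convert! h2 using 1
    funext s
    congr 1
    ext1 <;> simp [et]
  · intro i z hz
    rw [hind (fun z => du z i) z hz]
    refine line_ind hGo hz ?_
    convert! h.dx z (hGQ hz) i using 1
    funext s
    congr 1
    ext1 <;> simp [ex]
  · intro i j z hz
    rw [hind (fun z => d2u z i j) z hz]
    refine line_ind hGo hz ?_
    convert! h.dxx z (hGQ hz) i j using 1
    funext s
    have e : z + s • ex j = (z.1, z.2 + s • EuclideanSpace.single j (1 : ℝ)) := by
      ext1 <;> simp [ex]
    rw [e]
  · exact (h.uc.mono (hGQ.trans subset_closure)).congr fun z hz => hind u z hz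
  · rw [hind u z1 (hDG hz1)]; exact hwz1
  · intro z hz hpos
    rw [hind u z (hDG hz)] at hpos
    exact hfw z hz hpos
  · intro z hz hpos
    rw [hind u z (hDG hz)] at hpos
    have e : (WithLp.toLp 2 (fun i => G.indicator (fun z => du z i) z) : EE d) = du z := by
      ext i; simp [hDG hz]
    have e2 : ∀ i j, G.indicator (fun z => d2u z i j) z = d2u z i j := fun i j => hind _ z (hDG hz)
    rw [e, hind ut z (hDG hz)]
    simp only [e2]
    exact hH z hz hpos

lemma pointwise_est {d : ℕ} {δ K M μ : ℝ} {a : XX d → Matrix (Fin d) (Fin d) ℝ} {b : XX d → EE d} {c : XX d → ℝ}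
    {Q : Set (XX d)} {u ut : XX d → ℝ} {du : XX d → EE d} {d2u : XX d → Matrix (Fin d) (Fin d) ℝ}
    (h : PDat δ K M μ a b c Q u ut du d2u) {z0 : XX d} (hz0 : z0 ∈ Q) (hu0 : 0 < u z0) :
    ENNReal.ofReal (δ ^ d * M ^ d * (μ * u z0 / (64 * (5 + 3 * K) * M ^ 2)) ^ (d + 1)) * volume (Metric.ball (0 : EE d) 1) ≤
      ∫⁻ z in Q, ENNReal.ofReal (ffun μ a b c u ut du d2u z / phiw K M μ (z - z0)) ^ (d + 1) := by
  have hK1 := h.K1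
  have hM := h.M0
  have hμ := h.μ0
  have hμM := h.μM
  set φ : XX d → ℝ := fun z => phiw K M μ (z - z0) with hφ
  have hφ1 : ∀ z, 1 ≤ φ z := fun z => phiw_pos K M μ (z - z0)
  have hφp : ∀ z, 0 < φ z := fun z => one_pos.trans_le (hφ1 z)
  obtain ⟨Cu, hCu⟩ := h.ub
  set E : Set ℝ := (fun z => u z / φ z) '' Q with hE
  have hEb : BddAbove E := by
    refine ⟨Cu, ?_⟩
    rintro _ ⟨z, hz, rfl⟩
    have := (abs_le.1 (hCu z (subset_closure hz)))
    have hC0 : 0 ≤ Cu := (abs_nonneg _).trans (hCu z (subset_closure hz))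
    show u z / φ z ≤ Cu
    rw [div_le_iff₀ (hφp z)]
    nlinarith [hφ1 z]
  set V := sSup E with hVdef
  have huV : ∀ z ∈ Q, u z ≤ V * φ z := fun z hz => by
    rw [← div_le_iff₀ (hφp z)]
    exact le_csSup hEb ⟨z, hz, rfl⟩
  have hφ0 : φ z0 = 1 := by simp [hφ, phiw]
  have hVu : u z0 ≤ V := by
    have := huV z0 hz0
    rwa [hφ0, mul_one] at this
  have hV : 0 < V := hu0.trans_le hVu
  set κ : ℝ := 1 / (4 * (5 + 3 * K)) with hκ
  have hκ0 : 0 < κ := by positivity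
  set A := κ * μ / M ^ 2 * V with hA
  have hA0 : 0 < A := by positivity
  have hA12 : A ≤ V / 12 := by
    have : κ * μ / M ^ 2 ≤ 1 / 12 := by
      rw [hκ, div_mul_eq_mul_div, div_div, div_le_div_iff₀ (by positivity) (by norm_num)]
      nlinarith [sq_nonneg M]
    nlinarith
  obtain ⟨_, ⟨z1, hz1, rfl⟩, hz1V⟩ := exists_lt_of_lt_csSup (s := E) ⟨_, z0, hz0, rfl⟩ (show V - A / 2 < sSup E by rw [← hVdef]; linarith)
  have hz1V : V - A / 2 < u z1 / φ z1 := hz1V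
  rw [lt_div_iff₀ (hφp z1)] at hz1V
  set B := A * φ z1 with hB
  have hB0 : 0 < B := mul_pos hA0 (hφp z1)
  have hB12 : B ≤ V * φ z1 / 12 := by nlinarith [hφp z1]
  have hVφ1 : 0 < V * φ z1 := mul_pos hV (hφp z1)
  set lam := μ / (8 * (K + 1)) with hlam
  set P := quadP (V - B) (V * lam ^ 2) (V * (lam / M) ^ 2) (B * M ^ 2) (B * M ^ 2) z0 z1 with hP
  have hPval : ∀ z, P z = V * φ z - B * (1 - M ^ 2 * ‖z.2 - z1.2‖ ^ 2 - M ^ 2 * (z.1 - z1.1)) := by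
    intro z
    simp only [hP, quadP, hφ, phiw, Prod.fst_sub, Prod.snd_sub]
    ring
  set r := 1 / M with hr
  have hr0 : 0 < r := by positivity
  obtain ⟨D, hDc, hDQ, hz1D, hDcyl, hDfw⟩ := domain_D h.Qo h.uc h.bd hz1 (ε := V * φ z1 / 8) (r := r) (T := 1 / M ^ 2)
    (by positivity) hr0 (by positivity) (by nlinarith)
  have hcomp : ∀ z ∈ D, φ z ≤ 2 * φ z1 ∧ φ z1 ≤ 2 * φ z := by
    intro z hz
    obtain ⟨c1, c2, c3⟩ := hDcyl z hz
    have e1 : |(z - z0).1 - (z1 - z0).1| ≤ 1 / M ^ 2 := by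
      simp only [Prod.fst_sub]
      rw [abs_le]; constructor <;> linarith
    have e2 : ‖(z - z0).2 - (z1 - z0).2‖ ≤ 1 / M := by
      have e3 : (z - z0).2 - (z1 - z0).2 = z.2 - z1.2 := by simp
      rw [e3]; exact c2
    exact ⟨phiw_comp hK1 hM hμ hμM e1 e2,
      phiw_comp hK1 hM hμ hμM (by rwa [abs_sub_comm]) (by rwa [norm_sub_rev])⟩
  have hwpos : ∀ z ∈ D, 0 < u z - P z → V * φ z1 / 4 ≤ u z ∧ V * φ z - B ≤ u z ∧
      0 < 1 - M ^ 2 * ‖z.2 - z1.2‖ ^ 2 - M ^ 2 * (z.1 - z1.1) := by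
    intro z hz hw
    obtain ⟨c1, c2, c3⟩ := hDcyl z hz
    obtain ⟨k1, k2⟩ := hcomp z hz
    rw [hPval] at hw
    have hle := huV z (hDQ hz)
    have n1 : 0 ≤ M ^ 2 * ‖z.2 - z1.2‖ ^ 2 := by positivity
    have n2 : 0 ≤ M ^ 2 * (z.1 - z1.1) := mul_nonneg (by positivity) (by linarith)
    have g2 : V * φ z - B ≤ u z := by
      have : B * (1 - M ^ 2 * ‖z.2 - z1.2‖ ^ 2 - M ^ 2 * (z.1 - z1.1)) ≤ B * 1 := by
        apply mul_le_mul_of_nonneg_left _ hB0.le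
        linarith
      linarith
    refine ⟨?_, g2, ?_⟩
    · have : V * φ z1 ≤ V * (2 * φ z) := by gcongr
      linarith
    · by_contra hcon
      push Not at hcon
      have := mul_nonpos_of_nonneg_of_nonpos hB0.le hcon
      linarith
  have hmain := abp_app h hDc hDQ (quadP_contDiff (V - B) (V * lam ^ 2) (V * (lam / M) ^ 2) (B * M ^ 2) (B * M ^ 2) z0 z1)
    hr0 hB0 hz1D (by
      rw [← hP, hPval]; simp; linarith) (fun z hz => (hDcyl z hz).2.1) (by
      intro z hz hw
      obtain ⟨g1, g2, g3⟩ := hwpos z hz hw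
      have n1 : 0 ≤ M ^ 2 * ‖z.2 - z1.2‖ ^ 2 := by positivity
      have n2 : 0 ≤ M ^ 2 * (z.1 - z1.1) := mul_nonneg (by positivity) (by linarith [(hDcyl z hz).1])
      refine hDfw z hz (by linarith) ?_ ?_
      · have : z.1 - z1.1 < 1 / M ^ 2 := by
          rw [lt_div_iff₀ (by positivity)]; linarith
        linarith
      · rw [hr, lt_div_iff₀ hM]
        have : (‖z.2 - z1.2‖ * M) ^ 2 < 1 := by rw [mul_pow]; linarith
        exact lt_of_pow_lt_pow_left₀ 2 (by norm_num) (by simpa using this)) (by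
      intro z hz hw
      obtain ⟨g1, g2, g3⟩ := hwpos z hz hw
      obtain ⟨k1, k2⟩ := hcomp z hz
      rw [quadP_fderiv, quadP_gradx]
      simp only [quadP_hessx]
      have hf : μ * u z - (ut z + (∑ i, ∑ j, a z i j * d2u z i j) + (∑ i, b z i * du z i) - c z * u z) ≤
        ffun μ a b c u ut du d2u z := le_max_left _ _
      set f := ffun μ a b c u ut du d2u z
      have hcu : 0 ≤ c z * u z := mul_nonneg (h.c0 z) (by linarith)
      have hsum : ∑ i, ∑ j, a z i j * (d2u z i j - if i = j then 2 * (V * (lam / M) ^ 2) + 2 * (B * M ^ 2) else 0) =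
          (∑ i, ∑ j, a z i j * d2u z i j) - (2 * (V * (lam / M) ^ 2) + 2 * (B * M ^ 2)) * (a z).trace := by
        simp only [mul_sub, Finset.sum_sub_distrib, mul_ite, mul_zero, Finset.sum_ite_eq, Finset.mem_univ, if_true,
          Matrix.trace, Matrix.diag, Finset.mul_sum]
        congr 1
        exact Finset.sum_congr rfl fun i _ => mul_comm _ _
      rw [hsum]
      have hbdu : ∑ i, b z i * du z i = inner ℝ (b z) (du z) := by
        simp [PiLp.inner_apply, mul_comm]
      rw [hbdu] at hf
      set g : EE d := (2 * (V * (lam / M) ^ 2)) • (z.2 - z0.2) + (2 * (B * M ^ 2)) • (z.2 - z1.2) with hg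
      have hin : inner ℝ (b z) (du z) ≤ M * ‖du z - g‖ + 2 * V * (lam / M) ^ 2 * M * ‖z.2 - z0.2‖ + 2 * B * M ^ 2 := by
        have e1 : inner ℝ (b z) (du z) = inner ℝ (b z) (du z - g) + inner ℝ (b z) g := by
          rw [← inner_add_right]; simp
        have e2 : ∀ y : EE d, inner ℝ (b z) y ≤ M * ‖y‖ := fun y =>
          (real_inner_le_norm _ _).trans (mul_le_mul_of_nonneg_right (h.bM z) (norm_nonneg _))
        have e3 : inner ℝ (b z) g ≤ (2 * (V * (lam / M) ^ 2)) * (M * ‖z.2 - z0.2‖) + (2 * (B * M ^ 2)) * (M * (1 / M)) := by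
          rw [hg, inner_add_right, inner_smul_right, inner_smul_right]
          have p1 : 0 ≤ 2 * (V * (lam / M) ^ 2) := by positivity
          have p2 : 0 ≤ 2 * (B * M ^ 2) := by positivity
          refine add_le_add (mul_le_mul_of_nonneg_left (e2 _) p1) (mul_le_mul_of_nonneg_left ((e2 _).trans ?_) p2)
          exact mul_le_mul_of_nonneg_left (hDcyl z hz).2.1 hM.le
        rw [mul_one_div_cancel hM.ne'] at e3
        have := e2 (du z - g)
        linarith
      have hs := scalar_ineq (c := 1 / (8 * (K + 1))) (lam := lam) (eta := lam / M) (τ := z.1 - z0.1) (X := ‖z.2 - z0.2‖)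
        (φ := φ z) (V := V) (B := B) (tr := (a z).trace) (u := u z) hK1 hM hμ hμM
        (one_div_mul_cancel (by positivity)) (by rw [hlam]; ring) (by rw [hlam]; field_simp)
        rfl hV hB0.le (by linarith [h.tr z]) (by
          have e : B * (5 + 3 * K) * M ^ 2 = μ * V * φ z1 / 4 := by
            rw [hB, hA, hκ]; field_simp
          rw [e]
          have : μ * V * φ z1 ≤ μ * V * (2 * φ z) := by gcongr
          linarith) g2
      have et1 : (et d).1 = 1 := rfl
      have et2 : (et d).2 = 0 := rfl
      rw [et1, et2]
      simp only [inner_zero_right, mul_zero, mul_one, add_zero]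
      have hBr : M * (B / (8 * r)) = B * M ^ 2 / 8 := by rw [hr]; field_simp
      have hms : M * (‖du z - g‖ - B / (8 * r)) = M * ‖du z - g‖ - B * M ^ 2 / 8 := by rw [mul_sub, hBr]
      rw [hms]
      linarith)
  -- volume computation
  have hvol : volume ((Ioo (B / 4) (3 * B / 8)) ×ˢ (Metric.ball (0 : EE d) (B / (8 * r)))) =
      ENNReal.ofReal (B / 8 * (B * M / 8) ^ d) * volume (Metric.ball (0 : EE d) 1) := by
    have : (volume : Measure (XX d)) = (volume : Measure ℝ).prod volume := rfl
    rw [this, Measure.prod_prod, Real.volume_Ioo, Measure.addHaar_ball_of_pos _ _ (show 0 < B / (8 * r) by positivity), finrank_euclideanSpace_fin,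
      ← mul_assoc, ← ENNReal.ofReal_mul (by linarith)]
    congr 3
    · ring
    · rw [hr]; field_simp
  have hbound : ∫⁻ z in D, ENNReal.ofReal (ffun μ a b c u ut du d2u z) ^ (d + 1) ≤
      ENNReal.ofReal ((2 * φ z1) ^ (d + 1)) * ∫⁻ z in Q, ENNReal.ofReal (ffun μ a b c u ut du d2u z / φ z) ^ (d + 1) := by
    rw [← lintegral_const_mul' _ _ (by simp)]
    refine (setLIntegral_mono_ae' hDc.measurableSet (.of_forall fun z hz => ?_)).trans (lintegral_mono_set hDQ)
    have hf0 : 0 ≤ ffun μ a b c u ut du d2u z := le_max_right _ _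
    have h2 : 0 ≤ 2 * φ z1 := by linarith [hφp z1]
    rw [ENNReal.ofReal_pow h2, ← mul_pow, ← ENNReal.ofReal_mul h2]
    gcongr
    rw [mul_div_assoc', le_div_iff₀ (hφp z), mul_comm]
    exact mul_le_mul_of_nonneg_right (hcomp z hz).1 hf0
  rw [hvol, ← mul_assoc, ← ENNReal.ofReal_mul (by have := h.δ0; positivity)] at hmain
  have hfin := hmain.trans hbound
  have hφ2 : 0 < (2 * φ z1) ^ (d + 1) := by have := hφp z1; positivity
  have hδ := h.δ0
  have hcalc : (2 * φ z1) ^ (d + 1) * (δ ^ d * M ^ d * (μ * u z0 / (64 * (5 + 3 * K) * M ^ 2)) ^ (d + 1)) ≤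
      δ ^ d * (B / 8 * (B * M / 8) ^ d) := by
    have e : B / 8 * (B * M / 8) ^ d = M ^ d * (B / 8) ^ (d + 1) := by
      rw [show B * M / 8 = M * (B / 8) by ring, mul_pow, pow_succ]; ring
    rw [e]
    have e2 : (2 * φ z1) * (μ * u z0 / (64 * (5 + 3 * K) * M ^ 2)) ≤ B / 8 := by
      have : B / 8 = (2 * φ z1) * (μ * V / (64 * (5 + 3 * K) * M ^ 2)) := by
        rw [hB, hA, hκ]; field_simp; ring
      rw [this]
      have := hφp z1
      gcongr
    calc _ = δ ^ d * (M ^ d * ((2 * φ z1) * (μ * u z0 / (64 * (5 + 3 * K) * M ^ 2))) ^ (d + 1)) := by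
          rw [mul_pow]; ring
      _ ≤ _ := by
        have := hφp z1
        gcongr
  have h3 : ENNReal.ofReal ((2 * φ z1) ^ (d + 1)) * (ENNReal.ofReal (δ ^ d * M ^ d * (μ * u z0 / (64 * (5 + 3 * K) * M ^ 2)) ^ (d + 1)) * volume (Metric.ball (0 : EE d) 1)) ≤
      ENNReal.ofReal ((2 * φ z1) ^ (d + 1)) * ∫⁻ z in Q, ENNReal.ofReal (ffun μ a b c u ut du d2u z / φ z) ^ (d + 1) := by
    rw [← mul_assoc, ← ENNReal.ofReal_mul hφ2.le]
    refine le_trans ?_ hfin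
    gcongr
  exact (ENNReal.mul_le_mul_iff_right (by simpa using hφ2) (by simp)).1 h3

lemma jensen_weight {α : Type*} [MeasurableSpace α] {ν : Measure α} {g w : α → ℝ≥0∞} (hg : Measurable g)
    (hw : Measurable w) {q : ℝ} (hq : 1 ≤ q) {I : ℝ≥0∞} (hI : ∫⁻ x, w x ∂ν ≤ I) :
    (∫⁻ x, g x * w x ∂ν) ^ q ≤ I ^ (q - 1) * ∫⁻ x, g x ^ q * w x ∂ν := by
  have h := eLpNorm'_le_eLpNorm'_mul_rpow_measure_univ (μ := ν.withDensity w) (f := g) one_pos hq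
    hg.aestronglyMeasurable
  have hq0 : 0 < q := by linarith
  simp only [eLpNorm', enorm_eq_self, ENNReal.rpow_one, div_one] at h
  rw [lintegral_withDensity_eq_lintegral_mul _ hw hg, lintegral_withDensity_eq_lintegral_mul _ hw (hg.pow_const q),
    withDensity_apply _ MeasurableSet.univ, setLIntegral_univ] at h
  simp only [Pi.mul_apply] at h
  have h2 := ENNReal.rpow_le_rpow h hq0.le
  rw [ENNReal.mul_rpow_of_nonneg _ _ hq0.le, ← ENNReal.rpow_mul, ← ENNReal.rpow_mul, one_div_mul_cancel hq0.ne',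
    ENNReal.rpow_one, sub_mul, one_mul, one_div_mul_cancel hq0.ne'] at h2
  simp only [mul_comm (w _)] at h2
  refine h2.trans ?_
  rw [mul_comm]
  gcongr

lemma conv_est {d : ℕ} {n : ℕ} {Q : Set (XX d)} {U F ψ : XX d → ℝ≥0∞} (hQ : MeasurableSet Q)
    (hF : Measurable F) (hψ : Measurable ψ) {A I : ℝ≥0∞} (hI : ∫⁻ z, ψ z ≤ I) (hItop : I ≠ ⊤) (hI0 : I ≠ 0) {q : ℝ} (hq : 1 ≤ q)
    (h : ∀ z0 ∈ Q, A * U z0 ^ n ≤ ∫⁻ z in Q, F z ^ n * ψ (z - z0)) :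
    A ^ q * ∫⁻ z in Q, U z ^ ((n : ℝ) * q) ≤ I ^ q * ∫⁻ z in Q, F z ^ ((n : ℝ) * q) := by
  have hq0 : 0 < q := by linarith
  have e : ∀ x : ℝ≥0∞, x ^ ((n : ℝ) * q) = (x ^ n) ^ q := fun x => by
    rw [ENNReal.rpow_mul, ENNReal.rpow_natCast]
  simp only [e]
  have s1 : ∀ z0 ∈ Q, A ^ q * (U z0 ^ n) ^ q ≤ I ^ (q - 1) * ∫⁻ z in Q, (F z ^ n) ^ q * ψ (z - z0) := by
    intro z0 hz0
    rw [← ENNReal.mul_rpow_of_nonneg _ _ hq0.le]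
    refine (ENNReal.rpow_le_rpow (h z0 hz0) hq0.le).trans ?_
    refine jensen_weight (hF.pow_const n) (hψ.comp (measurable_id.sub_const z0)) hq ?_
    refine (setLIntegral_le_lintegral _ _).trans ?_
    have := lintegral_sub_right_eq_self (μ := (volume : Measure (XX d))) ψ z0
    exact this.le.trans hI
  have hm : Measurable fun x : XX d × XX d => (F x.2 ^ n) ^ q * ψ (x.2 - x.1) :=
    (((hF.comp measurable_snd).pow_const n).pow_const q).mul (hψ.comp (measurable_snd.sub measurable_fst))
  have e1 : A ^ q * ∫⁻ z in Q, (U z ^ n) ^ q ≤ ∫⁻ z0 in Q, A ^ q * (U z0 ^ n) ^ q :=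
    lintegral_const_mul_le _ _
  have hI1 : I ^ (q - 1) ≠ ⊤ := ENNReal.rpow_ne_top_of_nonneg (by linarith) hItop
  calc _ ≤ ∫⁻ z0 in Q, A ^ q * (U z0 ^ n) ^ q := e1
    _ ≤ ∫⁻ z0 in Q, I ^ (q - 1) * ∫⁻ z in Q, (F z ^ n) ^ q * ψ (z - z0) := setLIntegral_mono_ae' hQ (.of_forall s1)
    _ = I ^ (q - 1) * ∫⁻ z0 in Q, ∫⁻ z in Q, (F z ^ n) ^ q * ψ (z - z0) := lintegral_const_mul' _ _ hI1
    _ = I ^ (q - 1) * ∫⁻ z in Q, ∫⁻ z0 in Q, (F z ^ n) ^ q * ψ (z - z0) := by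
        rw [lintegral_lintegral_swap hm.aemeasurable]
    _ ≤ I ^ (q - 1) * ∫⁻ z in Q, (F z ^ n) ^ q * I := by
        gcongr with z
        rw [lintegral_const_mul _ (show Measurable fun z0 => ψ (z - z0) from hψ.comp (measurable_const.sub measurable_id))]
        gcongr
        refine (setLIntegral_le_lintegral _ _).trans ?_
        exact (lintegral_sub_left_eq_self ψ z).le.trans hI
    _ = _ := by
        rw [lintegral_mul_const' _ _ hItop, mul_comm _ I, ← mul_assoc]
        congr 1
        nth_rewrite 2 [← ENNReal.rpow_one I]
        rw [← ENNReal.rpow_add _ _ hI0 hItop]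
        congr 1; ring

lemma lint_scale {E : Type*} [NormedAddCommGroup E] [NormedSpace ℝ E] [MeasurableSpace E] [BorelSpace E]
    [FiniteDimensional ℝ E] (ν : Measure E) [ν.IsAddHaarMeasure] {f : E → ℝ≥0∞} (hf : Measurable f) {r : ℝ} (hr : 0 < r) :
    ∫⁻ x, f (r • x) ∂ν = ENNReal.ofReal ((r ^ Module.finrank ℝ E)⁻¹) * ∫⁻ x, f x ∂ν := by
  have h := Measure.map_addHaar_smul ν hr.ne'
  rw [← lintegral_map (f := f) (g := fun x => r • x) hf (measurable_const_smul r), h, lintegral_smul_measure,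
    abs_of_pos (by positivity)]
  rfl

lemma weight_int (d : ℕ) (hd : 1 ≤ d) : ∃ C : ℝ, 0 < C ∧ ∀ K M μ : ℝ, 1 ≤ K → 0 < M → 0 < μ →
    ∫⁻ y : XX d, ENNReal.ofReal (1 / phiw K M μ y) ^ (d + 1) ≤
      ENNReal.ofReal (C * ((μ / (8 * (K + 1)))⁻¹ * ((μ / (8 * (K + 1)) / M) ^ d)⁻¹)) := by
  set g1 : ℝ → ℝ≥0∞ := fun t => ENNReal.ofReal ((1 + ‖t‖ ^ 2) ^ (-(2 : ℝ) / 2)) with hg1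
  set g2 : EE d → ℝ≥0∞ := fun x => ENNReal.ofReal ((1 + ‖x‖ ^ 2) ^ (-(2 * d : ℝ) / 2)) with hg2
  have m1 : Measurable g1 := by simp only [hg1]; fun_prop
  have m2 : Measurable g2 := by simp only [hg2]; fun_prop
  have f1 : ∫⁻ t, g1 t ≠ ⊤ := (integrable_rpow_neg_one_add_norm_sq (E := ℝ) (μ := volume) (r := 2) (by simp)).lintegral_lt_top.ne
  have f2 : ∫⁻ x, g2 x ≠ ⊤ := (integrable_rpow_neg_one_add_norm_sq (E := EE d) (μ := volume) (r := 2 * d) (by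
    have : (1 : ℝ) ≤ d := by exact_mod_cast hd
    simp only [finrank_euclideanSpace_fin]; linarith)).lintegral_lt_top.ne
  refine ⟨(∫⁻ t, g1 t).toReal * (∫⁻ x, g2 x).toReal + 1, by positivity, fun K M μ hK hM hμ => ?_⟩
  set lam := μ / (8 * (K + 1)) with hlam
  have hl : 0 < lam := by have : 0 < K + 1 := by linarith
                          positivity
  have hη : 0 < lam / M := by positivity
  have hb : ∀ y : XX d, ENNReal.ofReal (1 / phiw K M μ y) ^ (d + 1) ≤ g1 (lam • y.1) * g2 ((lam / M) • y.2) := by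
    intro y
    have hp := phiw_pos K M μ y
    have a1 : 0 ≤ lam ^ 2 * y.1 ^ 2 := by positivity
    have a2 : 0 ≤ (lam / M) ^ 2 * ‖y.2‖ ^ 2 := by positivity
    rw [← ENNReal.ofReal_pow (by positivity), hg1, hg2]
    simp only
    rw [← ENNReal.ofReal_mul (by positivity)]
    apply ENNReal.ofReal_le_ofReal
    have n1 : ‖lam • y.1‖ ^ 2 = lam ^ 2 * y.1 ^ 2 := by
      rw [norm_smul, mul_pow, Real.norm_eq_abs, Real.norm_eq_abs, sq_abs, sq_abs]
    have n2 : ‖(lam / M) • y.2‖ ^ 2 = (lam / M) ^ 2 * ‖y.2‖ ^ 2 := by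
      rw [norm_smul, mul_pow, Real.norm_eq_abs, sq_abs]
    rw [n1, n2, show (-(2 : ℝ) / 2) = -1 by norm_num, Real.rpow_neg_one, show (-(2 * d : ℝ) / 2) = -(d : ℝ) by ring,
      Real.rpow_neg (by positivity), Real.rpow_natCast, one_div, pow_succ, mul_comm, inv_pow]
    have b1 : 1 + lam ^ 2 * y.1 ^ 2 ≤ phiw K M μ y := by unfold phiw; rw [← hlam]; linarith
    have b2 : 1 + (lam / M) ^ 2 * ‖y.2‖ ^ 2 ≤ phiw K M μ y := by unfold phiw; rw [← hlam]; linarith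
    gcongr
  refine (lintegral_mono hb).trans ?_
  have hv : (volume : Measure (XX d)) = (volume : Measure ℝ).prod volume := rfl
  rw [hv, lintegral_prod_mul (f := fun t => g1 (lam • t)) (g := fun x => g2 ((lam / M) • x))
    (m1.comp (measurable_const_smul lam)).aemeasurable (m2.comp (measurable_const_smul (lam / M))).aemeasurable,
    lint_scale volume m1 hl, lint_scale volume m2 hη]
  rw [← ENNReal.ofReal_toReal f1, ← ENNReal.ofReal_toReal f2, ← ENNReal.ofReal_mul (by positivity),
    ← ENNReal.ofReal_mul (by positivity), ← ENNReal.ofReal_mul (by positivity)]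
  apply ENNReal.ofReal_le_ofReal
  rw [finrank_euclideanSpace_fin, Module.finrank_self, pow_one,
    ENNReal.toReal_ofReal ENNReal.toReal_nonneg, ENNReal.toReal_ofReal ENNReal.toReal_nonneg]
  have : 0 < lam⁻¹ * ((lam / M) ^ d)⁻¹ := by positivity
  rw [add_mul]
  nlinarith

lemma alg_id (d : ℕ) {C δ β L k M μ : ℝ} (hδ : 0 < δ) (hβ : 0 < β) (hL : 0 < L) (hk : 0 < k) (hM : 0 < M) (hμ : 0 < μ) :
    C * ((μ / L)⁻¹ * ((μ / L / M) ^ d)⁻¹) * (μ ^ 2) ^ (d + 1) =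
      δ ^ d * M ^ d * (μ / (k * M ^ 2)) ^ (d + 1) * β * (C / (δ ^ d * β) * (L * k) ^ (d + 1) * (M ^ 2) ^ (d + 1)) := by
  have e1 : (μ / L / M) ^ d = μ ^ d / (L ^ d * M ^ d) := by rw [div_pow, div_pow]; field_simp
  have e2 : (μ / (k * M ^ 2)) ^ (d + 1) = μ ^ (d + 1) / (k ^ (d + 1) * (M ^ 2) ^ (d + 1)) := by rw [div_pow, mul_pow]
  have e3 : (μ ^ 2) ^ (d + 1) = μ ^ (d + 1) * (μ ^ d * μ) := by rw [← pow_succ, ← mul_pow, sq]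
  rw [e1, e2, e3, mul_pow L, pow_succ L]
  field_simp

lemma lp_est (d : ℕ) (hd : 1 ≤ d) (δ K p : ℝ) (hδ : 0 < δ) (hK : 1 ≤ K) (hp : (d : ℝ) + 1 ≤ p) :
    ∃ N : ℝ, 0 < N ∧ ∀ {M μ : ℝ} {a : XX d → Matrix (Fin d) (Fin d) ℝ} {b : XX d → EE d} {c : XX d → ℝ}
    {Q : Set (XX d)} {u ut : XX d → ℝ} {du : XX d → EE d} {d2u : XX d → Matrix (Fin d) (Fin d) ℝ},
    PDat δ K M μ a b c Q u ut du d2u →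
    ENNReal.ofReal (μ ^ 2) * (∫⁻ z in Q, ENNReal.ofReal (max (u z) 0) ^ p) ^ (1 / p) ≤
      ENNReal.ofReal (N * M ^ 2) * (∫⁻ z in Q, ENNReal.ofReal (ffun μ a b c u ut du d2u z) ^ p) ^ (1 / p) := by
  obtain ⟨C, hC, hw⟩ := weight_int d hd
  set β := (volume (Metric.ball (0 : EE d) 1)).toReal with hβ
  have hβt : volume (Metric.ball (0 : EE d) 1) ≠ ⊤ := measure_ball_lt_top.ne
  have hβ0 : 0 < β := ENNReal.toReal_pos (Metric.measure_ball_pos _ _ one_pos).ne' hβt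
  set k := 64 * (5 + 3 * K) with hk
  have hk0 : 0 < k := by positivity
  have hK1 : 0 < K + 1 := by linarith
  set N := (C / (δ ^ d * β)) ^ (1 / ((d + 1 : ℕ) : ℝ)) * (8 * (K + 1) * k) with hN
  have hN0 : 0 < N := by positivity
  have hNn : N ^ (d + 1) = C / (δ ^ d * β) * (8 * (K + 1) * k) ^ (d + 1) := by
    rw [hN, mul_pow, one_div, Real.rpow_inv_natCast_pow (by positivity) (by omega)]
  refine ⟨N, hN0, fun {M μ a b c Q u ut du d2u} h => ?_⟩
  have hM := h.M0
  have hμ := h.μ0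
  set A := ENNReal.ofReal (δ ^ d * M ^ d * (μ / (k * M ^ 2)) ^ (d + 1) * β) with hA
  set I := ENNReal.ofReal (C * ((μ / (8 * (K + 1)))⁻¹ * ((μ / (8 * (K + 1)) / M) ^ d)⁻¹)) with hI
  have hA0 : A ≠ 0 := by rw [hA]; simp only [ne_eq, ENNReal.ofReal_eq_zero, not_le]; positivity
  have hI0 : I ≠ 0 := by rw [hI]; simp only [ne_eq, ENNReal.ofReal_eq_zero, not_le]; positivity
  have hAt : A ≠ ⊤ := ENNReal.ofReal_ne_top
  have hIt : I ≠ ⊤ := ENNReal.ofReal_ne_top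
  set n : ℝ := ((d + 1 : ℕ) : ℝ) with hn
  have hn' : n = d + 1 := by rw [hn]; push_cast; ring
  have hn0 : 0 < n := by rw [hn']; positivity
  have hp0 : 0 < p := by rw [← hn'] at hp; linarith
  have hq : 1 ≤ p / n := by rw [le_div_iff₀ hn0]; linarith
  have hnq : n * (p / n) = p := by field_simp
  set f := ffun μ a b c u ut du d2u with hf
  have hφm : Measurable (phiw (d := d) K M μ) := by unfold phiw; fun_prop
  have hψm : Measurable fun y : XX d => ENNReal.ofReal (1 / phiw K M μ y) ^ (d + 1) :=
    (ENNReal.measurable_ofReal.comp (measurable_const.div hφm)).pow_const _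
  have hmain := conv_est (n := d + 1) (U := fun z => ENNReal.ofReal (max (u z) 0)) (F := fun z => ENNReal.ofReal (f z))
    (A := A) (I := I) (q := p / n) h.Qo.measurableSet (ffun_measurable h).ennreal_ofReal hψm
    (hw K M μ hK hM hμ) hIt hI0 hq (by
      intro z0 hz0
      rcases le_or_gt (u z0) 0 with h0 | h0
      · simp [max_eq_right h0]
      have hpe := pointwise_est h hz0 h0
      rw [max_eq_left h0.le]
      have e1 : A * ENNReal.ofReal (u z0) ^ (d + 1) = ENNReal.ofReal (δ ^ d * M ^ d * (μ * u z0 / (k * M ^ 2)) ^ (d + 1)) * volume (Metric.ball (0 : EE d) 1) := by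
        rw [← ENNReal.ofReal_toReal hβt, ← hβ, hA, ← ENNReal.ofReal_pow h0.le, ← ENNReal.ofReal_mul (by positivity),
          ← ENNReal.ofReal_mul (by positivity)]
        congr 1
        rw [show μ * u z0 / (k * M ^ 2) = μ / (k * M ^ 2) * u z0 by ring, mul_pow _ (u z0)]
        ring
      rw [e1]
      refine hpe.trans (le_of_eq ?_)
      congr 1
      funext z
      rw [← mul_pow, ← ENNReal.ofReal_mul (show 0 ≤ f z from le_max_right _ _), mul_one_div])
  rw [← hn, hnq] at hmain
  set X := ∫⁻ z in Q, ENNReal.ofReal (max (u z) 0) ^ p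
  set Y := ∫⁻ z in Q, ENNReal.ofReal (f z) ^ p
  have h1 := ENNReal.rpow_le_rpow hmain (show 0 ≤ 1 / p by positivity)
  have hp1 : 0 ≤ 1 / p := by positivity
  have hqp : p / n * (1 / p) = 1 / n := by field_simp
  rw [ENNReal.mul_rpow_of_nonneg _ _ hp1, ENNReal.mul_rpow_of_nonneg _ _ hp1, ← ENNReal.rpow_mul, ← ENNReal.rpow_mul, hqp] at h1
  have hn1 : 0 ≤ 1 / n := by positivity
  have hroot : ∀ x : ℝ, 0 ≤ x → (ENNReal.ofReal (x ^ (d + 1))) ^ (1 / n) = ENNReal.ofReal x := by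
    intro x hx
    rw [ENNReal.ofReal_pow hx, ← ENNReal.rpow_natCast, ← ENNReal.rpow_mul, ← hn, mul_one_div_cancel hn0.ne', ENNReal.rpow_one]
  have hIA : I ^ (1 / n) * ENNReal.ofReal (μ ^ 2) = A ^ (1 / n) * ENNReal.ofReal (N * M ^ 2) := by
    rw [← hroot (μ ^ 2) (by positivity), ← hroot (N * M ^ 2) (by positivity), ← ENNReal.mul_rpow_of_nonneg _ _ hn1,
      ← ENNReal.mul_rpow_of_nonneg _ _ hn1, hA, hI, ← ENNReal.ofReal_mul (by positivity), ← ENNReal.ofReal_mul (by positivity)]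
    congr 2
    rw [mul_pow N, hNn]
    have hL : 0 < 8 * (K + 1) := by linarith
    exact alg_id d hδ hβ0 hL hk0 hM hμ
  have h2 : A ^ (1 / n) * (ENNReal.ofReal (μ ^ 2) * X ^ (1 / p)) ≤ A ^ (1 / n) * (ENNReal.ofReal (N * M ^ 2) * Y ^ (1 / p)) := by
    calc _ = ENNReal.ofReal (μ ^ 2) * (A ^ (1 / n) * X ^ (1 / p)) := by ring
      _ ≤ ENNReal.ofReal (μ ^ 2) * (I ^ (1 / n) * Y ^ (1 / p)) := by gcongr
      _ = (I ^ (1 / n) * ENNReal.ofReal (μ ^ 2)) * Y ^ (1 / p) := by ring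
      _ = _ := by rw [hIA]; ring
  refine (ENNReal.mul_le_mul_iff_right ?_ ?_).1 h2
  · exact (ENNReal.rpow_pos (pos_iff_ne_zero.2 hA0) hAt).ne'
  · exact ENNReal.rpow_ne_top_of_nonneg hn1 hAt

/-- **Corollary 4.7.** Assume the drift `b` is bounded, `|b| ≤ M`. Then for any `p ≥ d+1`,
`μ > 0`, and `u ∈ Ŵ^{1,2}_{d+1}(Q) ∩ C(Q̄)` with `u ≤ 0` on `∂'Q` and `limsup u ≤ 0` at
infinity if `Q` is unbounded:
`μ ‖u₊‖_{L_p(Q)} ≤ N (K+1) ‖(μu - Lu)₊‖_{L_p(Q)}` if `μ ≥ (K+1)M²`, and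
`μ² ‖u₊‖_{L_p(Q)} ≤ N (K+1)² M² ‖(μu - Lu)₊‖_{L_p(Q)}` if `μ ≤ (K+1)M²`,
where `N = N(δ,d,K,p)`. -/
theorem parabolic_resolvent_estimate_bounded_drift
    (d : ℕ) (hd : 1 ≤ d) (δ : ℝ) (hδ0 : 0 < δ) :
    ∀ (K : ℝ), 0 ≤ K →
    ∀ p : ℝ, (d : ℝ) + 1 ≤ p →
    ∃ N : ℝ, 0 < N ∧
    ∀ (a : ℝ × EuclideanSpace ℝ (Fin d) → Matrix (Fin d) (Fin d) ℝ)
      (b : ℝ × EuclideanSpace ℝ (Fin d) → EuclideanSpace ℝ (Fin d))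
      (c : ℝ × EuclideanSpace ℝ (Fin d) → ℝ) (M : ℝ),
      -- measurability of the coefficients
      (∀ i j, Measurable fun z => a z i j) →
      (∀ i, Measurable fun z => b z i) →
      Measurable c →
      -- Assumption 4.1 (i)
      (∀ z, (a z).IsSymm) →
      (∀ z (ξ : EuclideanSpace ℝ (Fin d)), δ * ‖ξ‖ ^ 2 ≤ ∑ i, ∑ j, a z i j * ξ i * ξ j) →
      (∀ z, Matrix.trace (a z) + 1 ≤ K) →
      -- `b` is bounded with `M = sup |b|`
      0 ≤ M →
      (∀ z, ‖b z‖ ≤ M) →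
      (∀ z, 0 ≤ c z) →
      (∃ C : ℝ, ∀ z, c z ≤ C) →
      -- the domain `Q`
      ∀ (Q : Set (ℝ × EuclideanSpace ℝ (Fin d))), IsOpen Q →
      -- `u` and its derivatives
      ∀ (u ut : ℝ × EuclideanSpace ℝ (Fin d) → ℝ)
        (du : ℝ × EuclideanSpace ℝ (Fin d) → EuclideanSpace ℝ (Fin d))
        (d2u : ℝ × EuclideanSpace ℝ (Fin d) → Matrix (Fin d) (Fin d) ℝ),
        Measurable u → Measurable ut →
        (∀ i, Measurable fun z => du z i) →
        (∀ i j, Measurable fun z => d2u z i j) →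
        (∀ z ∈ Q, HasDerivAt (fun s => u (s, z.2)) (ut z) z.1) →
        (∀ z ∈ Q, ∀ i,
          HasDerivAt (fun s : ℝ => u (z.1, z.2 + s • EuclideanSpace.single i (1 : ℝ))) (du z i) 0) →
        (∀ z ∈ Q, ∀ i j,
          HasDerivAt (fun s : ℝ => du (z.1, z.2 + s • EuclideanSpace.single j (1 : ℝ)) i)
            (d2u z i j) 0) →
        -- `u ∈ Ŵ^{1,2}_{d+1}(Q)`
        (∀ G : Set (ℝ × EuclideanSpace ℝ (Fin d)), IsOpen G → Bornology.IsBounded G → G ⊆ Q →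
          IntegrableOn (fun z => |u z| ^ ((d : ℝ) + 1) + |ut z| ^ ((d : ℝ) + 1) +
            ‖du z‖ ^ ((d : ℝ) + 1) + frobNorm (d2u z) ^ ((d : ℝ) + 1)) G volume) →
        -- `u ∈ C(Q̄)` (bounded and continuous)
        ContinuousOn u (closure Q) →
        (∃ M : ℝ, ∀ z ∈ closure Q, |u z| ≤ M) →
        -- `u ≤ 0` on `∂'Q`
        (∀ z ∈ parabolicBoundary Q, u z ≤ 0) →
        -- `limsup_{t+|x|→∞} u ≤ 0` in case `Q` is unbounded
        (¬ Bornology.IsBounded Q →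
          ∀ ε : ℝ, 0 < ε → ∃ R : ℝ, ∀ z ∈ Q, R ≤ z.1 + ‖z.2‖ → u z ≤ ε) →
        ∀ μ : ℝ, 0 < μ →
        (((K + 1) * M ^ 2 ≤ μ →
          ENNReal.ofReal μ *
              eLpNorm (fun z => max (u z) 0) (ENNReal.ofReal p) (volume.restrict Q)
            ≤ ENNReal.ofReal (N * (K + 1)) *
              eLpNorm (fun z => max (μ * u z -
                  (ut z + (∑ i, ∑ j, a z i j * d2u z i j) + (∑ i, b z i * du z i) - c z * u z)) 0)
                (ENNReal.ofReal p) (volume.restrict Q))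
        ∧ (μ ≤ (K + 1) * M ^ 2 →
          ENNReal.ofReal (μ ^ 2) *
              eLpNorm (fun z => max (u z) 0) (ENNReal.ofReal p) (volume.restrict Q)
            ≤ ENNReal.ofReal (N * (K + 1) ^ 2 * M ^ 2) *
              eLpNorm (fun z => max (μ * u z -
                  (ut z + (∑ i, ∑ j, a z i j * d2u z i j) + (∑ i, b z i * du z i) - c z * u z)) 0)
                (ENNReal.ofReal p) (volume.restrict Q))) := by
  intro K hK p hp
  by_cases hK1 : K < 1
  · refine ⟨1, one_pos, ?_⟩
    intro a b c M _ _ _ _ hell htr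
    exfalso
    have h1 := htr 0
    have h2 : 0 ≤ Matrix.trace (a 0) := by
      refine Finset.sum_nonneg fun i _ => ?_
      have h3 := hell 0 (EuclideanSpace.single i 1)
      have h4 : 0 ≤ δ * ‖(EuclideanSpace.single i (1 : ℝ) : EuclideanSpace ℝ (Fin d))‖ ^ 2 := by positivity
      have h5 := h4.trans h3
      simpa [Matrix.diag] using h5
    linarith
  push Not at hK1
  obtain ⟨N, hN, hest⟩ := lp_est d hd δ K p hδ0 hK1 hp
  refine ⟨N, hN, ?_⟩
  intro a b c M ham hbm hcm hsymm hell htr hM0 hbM hc0 _ Q hQ u ut du d2u hum hutm hdum hd2um hdt hdx hdxx hintg huc hub hbd _ μ hμ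
  have hp0 : 0 < p := by
    have : (0 : ℝ) ≤ d := by positivity
    linarith
  have hK2 : 0 < K + 1 := by linarith
  have key : ∀ M' : ℝ, M ≤ M' → μ ≤ (K + 1) * M' ^ 2 →
      ENNReal.ofReal (μ ^ 2) * eLpNorm (fun z => max (u z) 0) (ENNReal.ofReal p) (volume.restrict Q) ≤
      ENNReal.ofReal (N * M' ^ 2) * eLpNorm (fun z => max (μ * u z -
                  (ut z + (∑ i, ∑ j, a z i j * d2u z i j) + (∑ i, b z i * du z i) - c z * u z)) 0)
                (ENNReal.ofReal p) (volume.restrict Q) := by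
    intro M' hMM hμM
    have hM'0 : 0 < M' := by
      rcases (hM0.trans hMM).eq_or_lt with h0 | h0
      · rw [← h0] at hμM; simp at hμM; linarith
      · exact h0
    have hd : PDat δ K M' μ a b c Q u ut du d2u :=
      ⟨hδ0, hK1, hM'0, hμ, hμM, ham, hbm, hcm, hsymm, hell, htr, fun z => (hbM z).trans hMM, hc0, hQ, hum, hutm, hdum, hd2um,
        hdt, hdx, hdxx, hintg, huc, hub, hbd⟩
    have h1 := hest hd
    rw [eLpNorm_eq_lintegral_rpow_enorm_toReal (by simpa using hp0) ENNReal.ofReal_ne_top,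
      eLpNorm_eq_lintegral_rpow_enorm_toReal (by simpa using hp0) ENNReal.ofReal_ne_top, ENNReal.toReal_ofReal hp0.le]
    simp only [Real.enorm_of_nonneg (le_max_right _ (0 : ℝ))]
    exact h1
  constructor
  · intro hμM
    have hs : Real.sqrt (μ / (K + 1)) ^ 2 = μ / (K + 1) := Real.sq_sqrt (by positivity)
    have h1 := key (Real.sqrt (μ / (K + 1))) (by
      apply Real.le_sqrt_of_sq_le
      rw [le_div_iff₀ hK2]; linarith) (by rw [hs]; field_simp; exact le_rfl)
    rw [hs] at h1
    have h2 : ENNReal.ofReal (N * (μ / (K + 1))) ≤ ENNReal.ofReal μ * ENNReal.ofReal (N * (K + 1)) := by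
      rw [← ENNReal.ofReal_mul hμ.le]
      apply ENNReal.ofReal_le_ofReal
      have h3 : μ / (K + 1) ≤ μ * (K + 1) := by
        rw [div_le_iff₀ hK2]
        nlinarith [mul_pos hμ hK2]
      calc N * (μ / (K + 1)) ≤ N * (μ * (K + 1)) := by gcongr
        _ = _ := by ring
    have h4 := h1.trans (mul_le_mul_left h2 _)
    rw [sq, ENNReal.ofReal_mul hμ.le, mul_assoc, mul_assoc] at h4
    exact (ENNReal.mul_le_mul_iff_right (by simpa using hμ) ENNReal.ofReal_ne_top).1 h4
  · intro hμM
    refine (key M le_rfl hμM).trans ?_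
    gcongr
    have : 1 ≤ (K + 1) ^ 2 := by nlinarith
    nlinarith
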